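/- arXiv:1104.3793 — 2 statements merged into one kernel-verified Lean document; each statement's English description precedes it below -/
import Mathlib

section
/- Let H be a nonlocal vertex bialgebra, let U be a nonlocal vertex (left) H-module-algebra, and let V be a nonlocal vertex (left) H-comodule-algebra with coaction ρ(v) = b¹(v)⊗v². For u,u' ∈ U, v,v' ∈ V define Y_♯(u⊗v,x)(u'⊗v') = Y(u,x)Y(b¹(v),x)u' ⊗ Y(v²,x)v'. Then (U⊗V, Y_♯, 1⊗1) carries the structure of a nonlocal vertex algebra (the smash product U♯V). -/
open scoped TensorProduct BigOperators

noncomputable section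

/-- Integer binomial coefficient `C(n, k)` for `n : ℤ`, `k : ℕ`. -/
def zchoose (n : ℤ) (k : ℕ) : ℤ :=
  if 0 ≤ n then ((n.toNat).choose k : ℤ)
  else (-1) ^ k * ((((k : ℤ) - n - 1).toNat).choose k)

section Series

variable {V : Type*} [AddCommGroup V] [Module ℂ V]

/-- `a` is (the coefficient family of) an element of `V((x))`. -/
def IsLaurent (a : ℤ → V) : Prop := ∃ N : ℤ, ∀ n : ℤ, n < N → a n = 0

/-- `a` is an element of `V[[x]]`. -/
def IsPowerSeries (a : ℤ → V) : Prop := ∀ n : ℤ, n < 0 → a n = 0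

/-- `A` is an element of `V((x₁, x₂))` (first index: exponent of `x₁`). -/
def IsLaurent2 (A : ℤ → ℤ → V) : Prop :=
  ∃ N : ℤ, ∀ m n : ℤ, (m < N ∨ n < N) → A m n = 0

/-- `a` is an element of `V ⊗ ℂ((x)) ⊆ V((x))`: truncated below, with coefficients
lying in a finitely generated (i.e. finite dimensional) subspace. -/
def IsTensorLaurent (a : ℤ → V) : Prop :=
  IsLaurent a ∧ ∃ F : Submodule ℂ V, F.FG ∧ ∀ n, a n ∈ F

/-- Multiply the double series `A(x₁,x₂)` by `(x₁+x₂)^k`. -/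
def mulAddPow (k : ℕ) (A : ℤ → ℤ → V) : ℤ → ℤ → V := fun a b =>
  ∑ j ∈ Finset.range (k + 1), ((k.choose j : ℕ) : ℂ) • A (a - (k : ℤ) + j) (b - j)

/-- Multiply the double series `A(x₁,x₂)` by `(x₁-x₂)^k`. -/
def mulSubPow (k : ℕ) (A : ℤ → ℤ → V) : ℤ → ℤ → V := fun a b =>
  ∑ j ∈ Finset.range (k + 1),
    ((-1 : ℂ) ^ j * ((k.choose j : ℕ) : ℂ)) • A (a - (k : ℤ) + j) (b - j)

/-- Multiply the double series `A(x₁,x₂)` by `(x₂-x₁)^k`. -/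
def mulSubPow' (k : ℕ) (A : ℤ → ℤ → V) : ℤ → ℤ → V := fun a b =>
  ∑ j ∈ Finset.range (k + 1),
    ((-1 : ℂ) ^ j * ((k.choose j : ℕ) : ℂ)) • A (a - j) (b - (k : ℤ) + j)

/-- Substitute `x₁ = x₀ + x₂` in `A(x₁,x₂)`, expanding in nonnegative powers of `x₂`.
The result is indexed by (exponent of `x₀`, exponent of `x₂`). -/
def substAdd02 (A : ℤ → ℤ → V) : ℤ → ℤ → V := fun a b =>
  ∑ᶠ i : ℕ, ((zchoose (a + i) i : ℤ) : ℂ) • A (a + i) (b - i)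

/-- Substitute `x₁ = x₂ + x₀` in `A(x₁,x₂)`, expanding in nonnegative powers of `x₀`.
The result is indexed by (exponent of `x₀`, exponent of `x₂`). -/
def substAdd20 (A : ℤ → ℤ → V) : ℤ → ℤ → V := fun a b =>
  if 0 ≤ a then ∑ᶠ m : ℤ, ((zchoose m a.toNat : ℤ) : ℂ) • A m (b - m + a) else 0

/-- Multiply the double series `A(x₁,x₂)` by `f(x₂ - x₁)`, expanded in nonnegative
powers of `x₁`. -/
def scalarMulSub (f : ℤ → ℂ) (A : ℤ → ℤ → V) : ℤ → ℤ → V := fun m n =>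
  ∑ᶠ (i : ℕ) (p : ℤ),
    ((-1 : ℂ) ^ i * ((zchoose p i : ℤ) : ℂ) * f p) • A (m - i) (n - p + i)

/-- Multiply a double series by a polynomial in two variables. -/
def polyMul2 (p : MvPolynomial (Fin 2) ℂ) (A : ℤ → ℤ → V) : ℤ → ℤ → V := fun m n =>
  ∑ d ∈ p.support, MvPolynomial.coeff d p • A (m - (d 0 : ℤ)) (n - (d 1 : ℤ))

/-- The relation `A ∼ B`: `p·A = p·B` for some nonzero polynomial `p(x₁,x₂)`. -/
def SimEq2 (A B : ℤ → ℤ → V) : Prop :=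
  ∃ p : MvPolynomial (Fin 2) ℂ, p ≠ 0 ∧ ∀ m n : ℤ, polyMul2 p A m n = polyMul2 p B m n

/-- `a` is an element of the iterated Laurent series space `V((x₁))⋯((x_n))`. -/
def IsIterLaurent : (n : ℕ) → ((Fin n → ℤ) → V) → Prop
  | 0, _ => True
  | n + 1, a =>
      (∃ N : ℤ, ∀ k : Fin (n + 1) → ℤ, k (Fin.last n) < N → a k = 0) ∧
      ∀ m : ℤ, IsIterLaurent n fun k => a (Fin.snoc k m)

end Series

/-- A nonlocal vertex algebra over `ℂ`, with `Y u v n` the coefficient of `x^n`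
in `Y(u,x)v` (so `u_m v = Y u v (-m-1)`). -/
structure NLVA (V : Type*) [AddCommGroup V] [Module ℂ V] where
  Y : V →ₗ[ℂ] V →ₗ[ℂ] (ℤ → V)
  one : V
  trunc : ∀ u v : V, IsLaurent (Y u v)
  vacuum_left : ∀ (v : V) (n : ℤ), Y one v n = if n = 0 then v else 0
  creation_reg : ∀ v : V, IsPowerSeries (Y v one)
  creation_zero : ∀ v : V, Y v one 0 = v
  weak_assoc : ∀ u v w : V, ∃ k : ℕ, ∀ a b : ℤ,
    mulAddPow k (substAdd02 fun m n => Y u (Y v w n) m) a b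
      = mulAddPow k (fun a' b' => Y (Y u v a') w b') a b

namespace NLVA

variable {U V K : Type*} [AddCommGroup U] [Module ℂ U] [AddCommGroup V] [Module ℂ V]
  [AddCommGroup K] [Module ℂ K]

/-- The coefficient `Y(·)_n(·)` as a bilinear map. -/
def Yc (𝒱 : NLVA V) (n : ℤ) : V →ₗ[ℂ] V →ₗ[ℂ] V :=
  𝒱.Y.compr₂ (LinearMap.proj n)

/-- The operator `D(v) = v_{-2}𝟙`, i.e. the coefficient of `x^1` in `Y(v,x)𝟙`. -/
def D (𝒱 : NLVA V) : V →ₗ[ℂ] V :=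
  (LinearMap.proj (1 : ℤ)).comp (𝒱.Y.flip 𝒱.one)

/-- Homomorphisms of nonlocal vertex algebras. -/
def IsHom (𝒰 : NLVA U) (𝒱 : NLVA V) (f : U →ₗ[ℂ] V) : Prop :=
  f 𝒰.one = 𝒱.one ∧ ∀ (a b : U) (n : ℤ), f (𝒰.Y a b n) = 𝒱.Y (f a) (f b) n

/-- `𝒦` is generated, as a nonlocal vertex algebra, by the subset `S`. -/
def IsGeneratedBy (𝒦 : NLVA K) (S : Set K) : Prop :=
  ∀ P : Submodule ℂ K, 𝒦.one ∈ P →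
    (∀ a ∈ P, ∀ b ∈ P, ∀ n : ℤ, 𝒦.Y a b n ∈ P) → S ⊆ P → P = ⊤

/-- `𝒰` is irreducible as a module over itself. -/
def SelfIrreducible (𝒰 : NLVA U) : Prop :=
  Nontrivial U ∧
    ∀ P : Submodule ℂ U, (∀ u : U, ∀ p ∈ P, ∀ n : ℤ, 𝒰.Y u p n ∈ P) → P = ⊥ ∨ P = ⊤

/-- The coefficients of the product `Y(v₁,x₁)⋯Y(v_n,x_n)𝟙`. -/
def prodY (𝒱 : NLVA V) : (n : ℕ) → (Fin n → V) → (Fin n → ℤ) → V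
  | 0, _, _ => 𝒱.one
  | n + 1, v, k => 𝒱.Y (v 0) (prodY 𝒱 n (fun i => v i.succ) fun i => k i.succ) (k 0)

/-- Non-degeneracy in the sense of Etingof–Kazhdan: the maps
`Z_n : V^{⊗n} ⊗ ℂ((x₁))⋯((x_n)) → V((x₁))⋯((x_n))` are injective. -/
def NonDegenerate (𝒱 : NLVA V) : Prop :=
  ∀ n : ℕ, 0 < n → ∀ (r : ℕ) (v : Fin r → Fin n → V) (f : Fin r → (Fin n → ℤ) → ℂ),
    (∀ j, IsIterLaurent n (f j)) →
    LinearIndependent ℂ (fun j : Fin r => PiTensorProduct.tprod ℂ (v j)) →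
    (∀ K' : Fin n → ℤ,
      (∑ j : Fin r, ∑ᶠ L : Fin n → ℤ,
        f j L • 𝒱.prodY n (v j) fun i => K' i - L i) = 0) →
    ∀ j, f j = 0

end NLVA

/-- Countable dimension over `ℂ`. -/
def CountableDim (U : Type*) [AddCommGroup U] [Module ℂ U] : Prop :=
  ∃ s : Set U, s.Countable ∧ Submodule.span ℂ s = ⊤

/-- `𝒱` satisfies `𝒮`-locality, i.e. is a weak quantum vertex algebra. -/
def SLocal {V : Type*} [AddCommGroup V] [Module ℂ V] (𝒱 : NLVA V) : Prop :=
  ∀ u v : V, ∃ (r : ℕ) (uu vv : Fin r → V) (f : Fin r → ℤ → ℂ) (k : ℕ),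
    (∀ i, IsLaurent (f i)) ∧ ∀ (w : V) (m n : ℤ),
      mulSubPow k (fun a b => 𝒱.Y u (𝒱.Y v w b) a) m n
        = mulSubPow k (fun a b => ∑ i, scalarMulSub (f i)
            (fun a' b' => 𝒱.Y (vv i) (𝒱.Y (uu i) w a') b') a b) m n

/-- A module for a nonlocal vertex algebra. -/
structure NLVAModule {V : Type*} [AddCommGroup V] [Module ℂ V] (𝒱 : NLVA V)
    (W : Type*) [AddCommGroup W] [Module ℂ W] where
  Yw : V →ₗ[ℂ] W →ₗ[ℂ] (ℤ → W)
  trunc : ∀ (v : V) (w : W), IsLaurent (Yw v w)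
  vacuum : ∀ (w : W) (n : ℤ), Yw 𝒱.one w n = if n = 0 then w else 0
  weak_assoc : ∀ (u v : V) (w : W), ∃ k : ℕ, ∀ a b : ℤ,
    mulAddPow k (substAdd02 fun m n => Yw u (Yw v w n) m) a b
      = mulAddPow k (fun a' b' => Yw (𝒱.Y u v a') w b') a b

section Twist

variable {U V : Type*} [AddCommGroup U] [Module ℂ U] [AddCommGroup V] [Module ℂ V]

/-- Coefficient of `x₁^m x₂^n` in `(Y(x₂)⊗1)R²³(x₁)R¹²(x₁+x₂)` applied to `v ⊗ u ⊗ u'`. -/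
def hex1RHS (𝒰 : NLVA U) (Rc : ℤ → (V ⊗[ℂ] U →ₗ[ℂ] U ⊗[ℂ] V))
    (v : V) (u u' : U) (m n : ℤ) : U ⊗[ℂ] V :=
  ∑ᶠ (i : ℕ) (c : ℤ),
    ((zchoose (m - c + i) i : ℤ) : ℂ) •
      (TensorProduct.map (TensorProduct.lift (𝒰.Yc (n - i))) LinearMap.id)
        ((TensorProduct.assoc ℂ U U V).symm
          ((LinearMap.lTensor U (Rc c))
            ((TensorProduct.assoc ℂ U V U)
              ((Rc (m - c + i) (v ⊗ₜ u)) ⊗ₜ u'))))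

/-- Coefficient of `x₁^m x₂^n` in `(1⊗Y(x₂))R¹²(x₁-x₂)R²³(x₁)` applied to `v ⊗ v' ⊗ u`. -/
def hex2RHS (𝒱 : NLVA V) (Rc : ℤ → (V ⊗[ℂ] U →ₗ[ℂ] U ⊗[ℂ] V))
    (v v' : V) (u : U) (m n : ℤ) : U ⊗[ℂ] V :=
  ∑ᶠ (i : ℕ) (c : ℤ),
    ((-1 : ℂ) ^ i * ((zchoose (m - c + i) i : ℤ) : ℂ)) •
      (LinearMap.lTensor U (TensorProduct.lift (𝒱.Yc (n - i))))
        ((TensorProduct.assoc ℂ U V V)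
          ((TensorProduct.map (Rc (m - c + i)) LinearMap.id)
            ((TensorProduct.assoc ℂ V U V).symm
              (v ⊗ₜ (Rc c (v' ⊗ₜ u))))))

/-- A twisting operator `R(x) : V ⊗ U → U ⊗ V ⊗ ℂ((x))` for the ordered pair `(U,V)`,
given by its family of coefficients `Rc n`. -/
structure TwistingOp (𝒰 : NLVA U) (𝒱 : NLVA V) where
  Rc : ℤ → (V ⊗[ℂ] U →ₗ[ℂ] U ⊗[ℂ] V)
  laurent : ∀ t : V ⊗[ℂ] U, IsTensorLaurent fun n => Rc n t
  vac_right : ∀ (v : V) (n : ℤ),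
    Rc n (v ⊗ₜ 𝒰.one) = if n = 0 then 𝒰.one ⊗ₜ v else 0
  vac_left : ∀ (u : U) (n : ℤ),
    Rc n (𝒱.one ⊗ₜ u) = if n = 0 then u ⊗ₜ 𝒱.one else 0
  hex1 : ∀ (v : V) (u u' : U) (m n : ℤ),
    Rc m (v ⊗ₜ (𝒰.Y u u' n)) = hex1RHS 𝒰 Rc v u u' m n
  hex2 : ∀ (v v' : V) (u : U) (m n : ℤ),
    Rc m ((𝒱.Y v v' n) ⊗ₜ u) = hex2RHS 𝒱 Rc v v' u m n

/-- `Sc` is a two-sided inverse of `Rc` as `ℂ((x))`-linear maps (coefficientwise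
convolution), with values in the tensor with `ℂ((x))`. -/
def IsInvPair {A B : Type*} [AddCommGroup A] [Module ℂ A] [AddCommGroup B] [Module ℂ B]
    (Rc : ℤ → (A →ₗ[ℂ] B)) (Sc : ℤ → (B →ₗ[ℂ] A)) : Prop :=
  (∀ t : B, IsTensorLaurent fun n => Sc n t) ∧
  (∀ (t : A) (n : ℤ), (∑ᶠ c : ℤ, Sc c (Rc (n - c) t)) = if n = 0 then t else 0) ∧
  (∀ (t : B) (n : ℤ), (∑ᶠ c : ℤ, Rc c (Sc (n - c) t)) = if n = 0 then t else 0)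

/-- The canonical embedding `u ↦ u ⊗ 𝟙`. -/
def iotaU (𝒱 : NLVA V) : U →ₗ[ℂ] U ⊗[ℂ] V := (TensorProduct.mk ℂ U V).flip 𝒱.one

/-- The canonical embedding `v ↦ 𝟙 ⊗ v`. -/
def iotaV (𝒰 : NLVA U) : V →ₗ[ℂ] U ⊗[ℂ] V := TensorProduct.mk ℂ U V 𝒰.one

/-- The operator `D ⊗ 1 + 1 ⊗ D` on `U ⊗ V`. -/
def DUV (𝒰 : NLVA U) (𝒱 : NLVA V) : U ⊗[ℂ] V →ₗ[ℂ] U ⊗[ℂ] V :=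
  LinearMap.rTensor V 𝒰.D + LinearMap.lTensor U 𝒱.D

/-- The coefficient of `x^n` in `Y_R(u⊗v, x)(u'⊗v') = (Y(x)⊗Y(x))R²³(-x)(u⊗v⊗u'⊗v')`. -/
def YRcoef (𝒰 : NLVA U) (𝒱 : NLVA V) (Rop : TwistingOp 𝒰 𝒱)
    (u : U) (v : V) (u' : U) (v' : V) (n : ℤ) : U ⊗[ℂ] V :=
  ∑ᶠ (c : ℤ) (a : ℤ),
    ((-1 : ℂ) ^ c) •
      (TensorProduct.map (𝒰.Yc a u) ((𝒱.Yc (n - c - a)).flip v'))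
        (Rop.Rc c (v ⊗ₜ u'))

/-- `𝒯` is the twisted tensor product nonlocal vertex algebra `U ⊗_R V`. -/
def IsTwistedTensor (𝒰 : NLVA U) (𝒱 : NLVA V) (Rop : TwistingOp 𝒰 𝒱)
    (𝒯 : NLVA (U ⊗[ℂ] V)) : Prop :=
  𝒯.one = 𝒰.one ⊗ₜ 𝒱.one ∧
  ∀ (u u' : U) (v v' : V) (n : ℤ),
    𝒯.Y (u ⊗ₜ v) (u' ⊗ₜ v') n = YRcoef 𝒰 𝒱 Rop u v u' v' n

end Twist

section Aux

variable {A B W T : Type*} [AddCommGroup A] [Module ℂ A] [AddCommGroup B] [Module ℂ B]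
  [AddCommGroup W] [Module ℂ W] [AddCommGroup T] [Module ℂ T]

/-- The linear map `(a ⊗ b) ↦ Y_A(a)_e (Y_B(b)_j w)`, i.e. the coefficient
of `Y_A(x₂)(1 ⊗ Y_B(x₁)) (· ⊗ · ⊗ w)` at `x₂^e x₁^j`. -/
def sandwichMod (YA : A →ₗ[ℂ] W →ₗ[ℂ] (ℤ → W)) (YB : B →ₗ[ℂ] W →ₗ[ℂ] (ℤ → W))
    (w : W) (e j : ℤ) : A ⊗[ℂ] B →ₗ[ℂ] W :=
  TensorProduct.lift
    ((YA.compr₂ (LinearMap.proj e)).compl₂ ((YB.compr₂ (LinearMap.proj j)).flip w))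

/-- Coefficient of `x₁^m x₂^n` in `Y_A(x₂)(1 ⊗ Y_B(x₁)) q(x₂ - x₁) (⋯ ⊗ w)`, where the
series `q` is evaluated at `x₂ - x₁`, expanded in nonnegative powers of `x₁`. -/
def twistRHS (YA : A →ₗ[ℂ] W →ₗ[ℂ] (ℤ → W)) (YB : B →ₗ[ℂ] W →ₗ[ℂ] (ℤ → W))
    (q : ℤ → A ⊗[ℂ] B) (w : W) : ℤ → ℤ → W := fun m n =>
  ∑ᶠ (i : ℕ) (p : ℤ),
    ((-1 : ℂ) ^ i * ((zchoose p i : ℤ) : ℂ)) •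
      sandwichMod YA YB w (n - p + i) (m - i) (q p)

/-- As `twistRHS`, but with `q` evaluated at `-x₂ + x₁`, expanded in nonnegative
powers of `x₂`. -/
def twistRHSalt (YA : A →ₗ[ℂ] W →ₗ[ℂ] (ℤ → W)) (YB : B →ₗ[ℂ] W →ₗ[ℂ] (ℤ → W))
    (q : ℤ → A ⊗[ℂ] B) (w : W) : ℤ → ℤ → W := fun m n =>
  ∑ᶠ (i : ℕ) (p : ℤ),
    ((-1 : ℂ) ^ i * ((zchoose p i : ℤ) : ℂ)) •
      sandwichMod YA YB w (n - i) (m - p + i) (q p)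

/-- Coefficient of `x^n` in `e^{xD} F(x)` where `F` is given by its coefficients. -/
def expD (Dop : T →ₗ[ℂ] T) (F : ℤ → T) (n : ℤ) : T :=
  ∑ᶠ j : ℕ, ((j.factorial : ℂ))⁻¹ • (Dop ^ j) (F (n - j))

end Aux

section YBE

variable {V : Type*} [AddCommGroup V] [Module ℂ V]

/-- The flip of the last two tensor factors of `(V⊗V)⊗V`. -/
def swap23 : (V ⊗[ℂ] V) ⊗[ℂ] V →ₗ[ℂ] (V ⊗[ℂ] V) ⊗[ℂ] V :=
  ((TensorProduct.assoc ℂ V V V).symm.toLinearMap).comp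
    ((LinearMap.lTensor V (TensorProduct.comm ℂ V V).toLinearMap).comp
      (TensorProduct.assoc ℂ V V V).toLinearMap)

/-- `S¹²` acting on `(V⊗V)⊗V`. -/
def S12m (Sc : ℤ → (V ⊗[ℂ] V →ₗ[ℂ] V ⊗[ℂ] V)) (c : ℤ) :
    (V ⊗[ℂ] V) ⊗[ℂ] V →ₗ[ℂ] (V ⊗[ℂ] V) ⊗[ℂ] V :=
  TensorProduct.map (Sc c) LinearMap.id

/-- `S²³` acting on `(V⊗V)⊗V`. -/
def S23m (Sc : ℤ → (V ⊗[ℂ] V →ₗ[ℂ] V ⊗[ℂ] V)) (c : ℤ) :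
    (V ⊗[ℂ] V) ⊗[ℂ] V →ₗ[ℂ] (V ⊗[ℂ] V) ⊗[ℂ] V :=
  ((TensorProduct.assoc ℂ V V V).symm.toLinearMap).comp
    ((LinearMap.lTensor V (Sc c)).comp (TensorProduct.assoc ℂ V V V).toLinearMap)

/-- `S¹³` acting on `(V⊗V)⊗V`. -/
def S13m (Sc : ℤ → (V ⊗[ℂ] V →ₗ[ℂ] V ⊗[ℂ] V)) (c : ℤ) :
    (V ⊗[ℂ] V) ⊗[ℂ] V →ₗ[ℂ] (V ⊗[ℂ] V) ⊗[ℂ] V :=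
  swap23.comp ((S12m Sc c).comp swap23)

/-- `S²¹(x) = σ S(x) σ`. -/
def S21c (Sc : ℤ → (V ⊗[ℂ] V →ₗ[ℂ] V ⊗[ℂ] V)) (c : ℤ) :
    V ⊗[ℂ] V →ₗ[ℂ] V ⊗[ℂ] V :=
  ((TensorProduct.comm ℂ V V).toLinearMap).comp
    ((Sc c).comp (TensorProduct.comm ℂ V V).toLinearMap)

/-- The quantum Yang–Baxter equation
`S¹²(x)S¹³(x+z)S²³(z) = S²³(z)S¹³(x+z)S¹²(x)` (coefficient of `x^a z^b`, with
`S¹³(x+z)` expanded in nonnegative powers of `z`). -/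
def QYBE (Sc : ℤ → (V ⊗[ℂ] V →ₗ[ℂ] V ⊗[ℂ] V)) : Prop :=
  ∀ (t : (V ⊗[ℂ] V) ⊗[ℂ] V) (a b : ℤ),
    (∑ᶠ (i : ℕ) (p : ℤ), ((zchoose p i : ℤ) : ℂ) •
        S12m Sc (a - p + i) (S13m Sc p (S23m Sc (b - i) t)))
      = ∑ᶠ (i : ℕ) (p : ℤ), ((zchoose p i : ℤ) : ℂ) •
          S23m Sc (b - i) (S13m Sc p (S12m Sc (a - p + i) t))

/-- Unitarity: `S(x) S²¹(-x) = 1`. -/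
def Unitary (Sc : ℤ → (V ⊗[ℂ] V →ₗ[ℂ] V ⊗[ℂ] V)) : Prop :=
  ∀ (t : V ⊗[ℂ] V) (n : ℤ),
    (∑ᶠ c : ℤ, ((-1 : ℂ) ^ (n - c)) • Sc c (S21c Sc (n - c) t))
      = if n = 0 then t else 0

/-- `[D ⊗ 1, S(x)] = -(d/dx) S(x)`. -/
def DComm1 (𝒱 : NLVA V) (Sc : ℤ → (V ⊗[ℂ] V →ₗ[ℂ] V ⊗[ℂ] V)) : Prop :=
  ∀ (t : V ⊗[ℂ] V) (n : ℤ),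
    (LinearMap.rTensor V 𝒱.D) (Sc n t) - Sc n ((LinearMap.rTensor V 𝒱.D) t)
      = (-((n : ℂ) + 1)) • Sc (n + 1) t

/-- `Y(u,x)v = e^{xD} Y(-x) S(-x)(v⊗u)`. -/
def SkewS (𝒱 : NLVA V) (Sc : ℤ → (V ⊗[ℂ] V →ₗ[ℂ] V ⊗[ℂ] V)) : Prop :=
  ∀ (u v : V) (n : ℤ),
    𝒱.Y u v n = expD 𝒱.D (fun p => ((-1 : ℂ) ^ p) •
      ∑ᶠ c : ℤ, (TensorProduct.lift (𝒱.Yc (p - c))) (Sc c (v ⊗ₜ u))) n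

/-- `S(x₁)(Y(x₂)⊗1) = (Y(x₂)⊗1)S²³(x₁)S¹³(x₁+x₂)`. -/
def HexY1 (𝒱 : NLVA V) (Sc : ℤ → (V ⊗[ℂ] V →ₗ[ℂ] V ⊗[ℂ] V)) : Prop :=
  ∀ (t : (V ⊗[ℂ] V) ⊗[ℂ] V) (m n : ℤ),
    Sc m ((TensorProduct.map (TensorProduct.lift (𝒱.Yc n)) LinearMap.id) t)
      = ∑ᶠ (i : ℕ) (p : ℤ), ((zchoose p i : ℤ) : ℂ) •
          (TensorProduct.map (TensorProduct.lift (𝒱.Yc (n - i))) LinearMap.id)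
            (S23m Sc (m - p + i) (S13m Sc p t))

/-- `S(x₁)(1⊗Y(x₂)) = (1⊗Y(x₂))S¹²(x₁-x₂)S¹³(x₁)`. -/
def HexY2 (𝒱 : NLVA V) (Sc : ℤ → (V ⊗[ℂ] V →ₗ[ℂ] V ⊗[ℂ] V)) : Prop :=
  ∀ (t : (V ⊗[ℂ] V) ⊗[ℂ] V) (m n : ℤ),
    Sc m ((LinearMap.lTensor V (TensorProduct.lift (𝒱.Yc n)))
        ((TensorProduct.assoc ℂ V V V) t))
      = ∑ᶠ (i : ℕ) (p : ℤ), ((-1 : ℂ) ^ i * ((zchoose p i : ℤ) : ℂ)) •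
          (LinearMap.lTensor V (TensorProduct.lift (𝒱.Yc (n - i))))
            ((TensorProduct.assoc ℂ V V V)
              (S12m Sc p (S13m Sc (m - p + i) t)))

/-- A quantum vertex algebra `(V, 𝒮)`. -/
structure QVA (V : Type*) [AddCommGroup V] [Module ℂ V] where
  alg : NLVA V
  sloc : SLocal alg
  Sc : ℤ → (V ⊗[ℂ] V →ₗ[ℂ] V ⊗[ℂ] V)
  laurent : ∀ t : V ⊗[ℂ] V, IsTensorLaurent fun n => Sc n t
  qybe : QYBE Sc
  unitary : Unitary Sc
  vac : ∀ (v : V) (n : ℤ), Sc n (alg.one ⊗ₜ v) = if n = 0 then alg.one ⊗ₜ v else 0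
  dcomm : DComm1 alg Sc
  skew : SkewS alg Sc
  hex : HexY1 alg Sc

end YBE

section Bialg

variable {H : Type*} [AddCommGroup H] [Module ℂ H]

/-- A nonlocal vertex bialgebra. -/
structure NLVBialg (H : Type*) [AddCommGroup H] [Module ℂ H] where
  alg : NLVA H
  comul : H →ₗ[ℂ] H ⊗[ℂ] H
  counit : H →ₗ[ℂ] ℂ
  coassoc : ∀ h : H, (LinearMap.lTensor H comul) (comul h)
      = (TensorProduct.assoc ℂ H H H) ((LinearMap.rTensor H comul) (comul h))
  counit_comul_left : ∀ h : H,
      (TensorProduct.lid ℂ H) ((LinearMap.rTensor H counit) (comul h)) = h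
  counit_comul_right : ∀ h : H,
      (TensorProduct.rid ℂ H) ((LinearMap.lTensor H counit) (comul h)) = h
  counit_one : counit alg.one = 1
  counit_mul : ∀ (a b : H) (n : ℤ),
      counit (alg.Y a b n) = if n = 0 then counit a * counit b else 0
  comul_one : comul alg.one = alg.one ⊗ₜ alg.one
  comul_mul : ∀ (a b : H) (n : ℤ),
      comul (alg.Y a b n)
        = ∑ᶠ p : ℤ, (TensorProduct.map₂ (alg.Yc p) (alg.Yc (n - p))) (comul a) (comul b)

/-- A nonlocal vertex `H`-module-algebra. -/
structure NLVModAlg (𝓗 : NLVBialg H) (U : Type*) [AddCommGroup U] [Module ℂ U] where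
  alg : NLVA U
  act : NLVAModule 𝓗.alg U
  scalar : ∀ (h : H) (u : U), IsTensorLaurent fun n => act.Yw h u n
  vac : ∀ (h : H) (n : ℤ),
      act.Yw h alg.one n = if n = 0 then 𝓗.counit h • alg.one else 0
  compat : ∀ (h : H) (u v : U) (m n : ℤ),
      act.Yw h (alg.Y u v n) m
        = ∑ᶠ (i : ℕ) (p : ℤ), ((-1 : ℂ) ^ i * ((zchoose p i : ℤ) : ℂ)) •
            (TensorProduct.lift
              (((alg.Yc (n - i)).comp ((act.Yw.compr₂ (LinearMap.proj p)).flip u)).compl₂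
                ((act.Yw.compr₂ (LinearMap.proj (m - p + i))).flip v)))
            (𝓗.comul h)

/-- A nonlocal vertex `H`-comodule-algebra. -/
structure NLVComodAlg (𝓗 : NLVBialg H) (V : Type*) [AddCommGroup V] [Module ℂ V] where
  alg : NLVA V
  rho : V →ₗ[ℂ] H ⊗[ℂ] V
  coassoc : ∀ v : V, (LinearMap.lTensor H rho) (rho v)
      = (TensorProduct.assoc ℂ H H V) ((LinearMap.rTensor V 𝓗.comul) (rho v))
  counit_rho : ∀ v : V,
      (TensorProduct.lid ℂ V) ((LinearMap.rTensor V 𝓗.counit) (rho v)) = v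
  rho_one : rho alg.one = 𝓗.alg.one ⊗ₜ alg.one
  rho_mul : ∀ (v v' : V) (n : ℤ),
      rho (alg.Y v v' n)
        = ∑ᶠ p : ℤ, (TensorProduct.map₂ (𝓗.alg.Yc p) (alg.Yc (n - p))) (rho v) (rho v')

/-- The coefficient of `x^n` in
`Y_♯(u⊗v, x)(u'⊗v') = Y(u,x)Y(b¹(v),x)u' ⊗ Y(v²,x)v'`. -/
def Ysharp (𝓗 : NLVBialg H) {U V : Type*} [AddCommGroup U] [Module ℂ U]
    [AddCommGroup V] [Module ℂ V] (MU : NLVModAlg 𝓗 U) (CV : NLVComodAlg 𝓗 V)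
    (u : U) (v : V) (u' : U) (v' : V) (n : ℤ) : U ⊗[ℂ] V :=
  ∑ᶠ (a : ℤ) (p : ℤ),
    (TensorProduct.map
      ((MU.alg.Yc a u).comp ((MU.act.Yw.compr₂ (LinearMap.proj p)).flip u'))
      ((CV.alg.Yc (n - a - p)).flip v'))
    (CV.rho v)

/-- Rearrangement `(H⊗V)⊗U → (H⊗U)⊗V`. -/
def smashSwap {U V : Type*} [AddCommGroup U] [Module ℂ U]
    [AddCommGroup V] [Module ℂ V] :
    (H ⊗[ℂ] V) ⊗[ℂ] U →ₗ[ℂ] (H ⊗[ℂ] U) ⊗[ℂ] V :=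
  ((TensorProduct.assoc ℂ H U V).symm.toLinearMap).comp
    ((LinearMap.lTensor H (TensorProduct.comm ℂ V U).toLinearMap).comp
      (TensorProduct.assoc ℂ H V U).toLinearMap)

/-- The coefficient of `x^n` in `R(x)(v⊗u) = Y(b¹(v),-x)u ⊗ v²`. -/
def Rsmash (𝓗 : NLVBialg H) {U V : Type*} [AddCommGroup U] [Module ℂ U]
    [AddCommGroup V] [Module ℂ V] (MU : NLVModAlg 𝓗 U) (CV : NLVComodAlg 𝓗 V)
    (n : ℤ) : V ⊗[ℂ] U →ₗ[ℂ] U ⊗[ℂ] V :=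
  ((-1 : ℂ) ^ n) •
    ((TensorProduct.map
        (TensorProduct.lift (MU.act.Yw.compr₂ (LinearMap.proj n))) LinearMap.id).comp
      (smashSwap.comp (LinearMap.rTensor U CV.rho)))

end Bialg

/-- The space `V((x))` of formal Laurent series, as a submodule of `ℤ → V`. -/
def laurentSubmodule (V : Type*) [AddCommGroup V] [Module ℂ V] : Submodule ℂ (ℤ → V) where
  carrier := {a | IsLaurent a}
  add_mem' := by
    rintro a b ⟨N, hN⟩ ⟨N', hN'⟩
    exact ⟨min N N', fun n hn => by simp [hN n (by omega), hN' n (by omega)]⟩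
  zero_mem' := ⟨0, fun _ _ => rfl⟩
  smul_mem' := by
    rintro c a ⟨N, hN⟩
    exact ⟨N, fun n hn => by simp [hN n hn]⟩

/-- The space `V((x))` of formal Laurent series. -/
abbrev Lau (V : Type*) [AddCommGroup V] [Module ℂ V] : Type _ := laurentSubmodule V

namespace Lau

variable {M N P Q : Type*} [AddCommGroup M] [Module ℂ M] [AddCommGroup N] [Module ℂ N]
  [AddCommGroup P] [Module ℂ P] [AddCommGroup Q] [Module ℂ Q]

theorem ext {a b : Lau M} (h : ∀ n, a.1 n = b.1 n) : a = b := Subtype.ext (funext h)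

@[simp]
theorem add_coeff (a b : Lau M) (n : ℤ) : (a + b).1 n = a.1 n + b.1 n := rfl
@[simp]
theorem sub_coeff (a b : Lau M) (n : ℤ) : (a - b).1 n = a.1 n - b.1 n := rfl
@[simp]
theorem smul_coeff (c : ℂ) (a : Lau M) (n : ℤ) : (c • a).1 n = c • a.1 n := rfl
@[simp]
theorem zero_coeff (n : ℤ) : (0 : Lau M).1 n = 0 := rfl

theorem sum_coeff {ι : Type*} (s : Finset ι) (f : ι → Lau M) (n : ℤ) :
    (∑ i ∈ s, f i).1 n = ∑ i ∈ s, (f i).1 n := by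
  simp [Finset.sum_apply]

/-- `a ∈ x^N V[[x]]`. -/
def Ge (K : ℤ) (a : Lau M) : Prop := ∀ n < K, a.1 n = 0

theorem exists_ge (a : Lau M) : ∃ K, Ge K a := a.2

theorem Ge.mono {K L : ℤ} {a : Lau M} (h : Ge K a) (hL : L ≤ K) : Ge L a :=
  fun n hn => h n (by omega)

/-- The monomial `m x^c`. -/
def single (c : ℤ) : M →ₗ[ℂ] Lau M where
  toFun m := ⟨fun n => if n = c then m else 0, c, fun n hn => by simp [hn.ne]⟩
  map_add' _ _ := ext fun n => by dsimp; split_ifs <;> simp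
  map_smul' _ _ := ext fun n => by dsimp; split_ifs <;> simp

theorem single_coeff (c : ℤ) (m : M) (n : ℤ) :
    (single c m).1 n = if n = c then m else 0 := rfl

theorem ge_single (c : ℤ) (m : M) : Ge c (single c m) := fun n hn => by
  simp [single_coeff, hn.ne]

/-- The operator `F` raises the order of Laurent series by at least `r`. -/
def Fil (r : ℤ) (F : Lau M → Lau N) : Prop := ∀ K a, Ge K a → Ge (K + r) (F a)

theorem Fil.comp {r s : ℤ} {F : Lau M → Lau N} {G : Lau N → Lau P} (hG : Fil s G)
    (hF : Fil r F) : Fil (r + s) fun a => G (F a) := fun K a ha => by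
  have := hG _ _ (hF K a ha)
  rwa [add_assoc] at this

/-- Linear operators of bounded order are determined by their values on monomials. -/
theorem hom_ext {F G : Lau M →ₗ[ℂ] Lau N} {r s : ℤ} (hF : Fil r F) (hG : Fil s G)
    (h : ∀ c m, F (single c m) = G (single c m)) (a : Lau M) : F a = G a := by
  refine ext fun n => ?_
  obtain ⟨K, hK⟩ := exists_ge a
  set C : ℤ := max (n + 1 - r) (n + 1 - s)
  set t : Lau M := ∑ c ∈ Finset.Ico K C, single c (a.1 c)
  have hr : Ge C (a - t) := by
    intro m hm
    simp only [sub_coeff, t, sum_coeff, single_coeff, Finset.sum_ite_eq, Finset.mem_Ico]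
    split_ifs with h1
    · simp
    · rw [hK m (by omega)]; simp
  have e : a = t + (a - t) := by abel
  have ht : F t = G t := by simp [t, map_sum, h]
  rw [e, map_add, map_add, ht, add_coeff, add_coeff, hF _ _ hr n (by omega),
    hG _ _ hr n (by omega)]

theorem conv_support (β : M →ₗ[ℂ] N →ₗ[ℂ] P) {K L : ℤ} {a : Lau M} {b : Lau N}
    (ha : Ge K a) (hb : Ge L b) (n : ℤ) :
    (Function.support fun c => β (a.1 c) (b.1 (n - c))) ⊆ ↑(Finset.Icc K (n - L)) := by
  intro c hc
  by_contra h
  simp only [Finset.coe_Icc, Set.mem_Icc, not_and_or, not_le] at h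
  apply hc
  rcases h with h | h
  · simp [ha c h]
  · simp [hb (n - c) (by omega)]

/-- The product of Laurent series induced by a bilinear map of the coefficients. -/
def conv (β : M →ₗ[ℂ] N →ₗ[ℂ] P) : Lau M →ₗ[ℂ] Lau N →ₗ[ℂ] Lau P :=
  LinearMap.mk₂ ℂ
    (fun a b => ⟨fun n => ∑ᶠ c, β (a.1 c) (b.1 (n - c)), by
      obtain ⟨K, hK⟩ := exists_ge a
      obtain ⟨L, hL⟩ := exists_ge b
      refine ⟨K + L, fun n hn => ?_⟩
      dsimp only
      rw [finsum_eq_sum_of_support_subset _ (conv_support β hK hL n),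
        Finset.Icc_eq_empty (by omega), Finset.sum_empty]⟩)
    (fun a a' b => ext fun n => by
      obtain ⟨K, hK⟩ := exists_ge a
      obtain ⟨K', hK'⟩ := exists_ge a'
      obtain ⟨L, hL⟩ := exists_ge b
      simp only [add_coeff, map_add, LinearMap.add_apply]
      exact finsum_add_distrib ((Finset.finite_toSet _).subset (conv_support β hK hL n))
        ((Finset.finite_toSet _).subset (conv_support β hK' hL n)))
    (fun c a b => ext fun n => by
      simp only [smul_coeff, map_smul, LinearMap.smul_apply]
      exact (smul_finsum _ _).symm)
    (fun a b b' => ext fun n => by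
      obtain ⟨K, hK⟩ := exists_ge a
      obtain ⟨L, hL⟩ := exists_ge b
      obtain ⟨L', hL'⟩ := exists_ge b'
      simp only [add_coeff, map_add]
      exact finsum_add_distrib ((Finset.finite_toSet _).subset (conv_support β hK hL n))
        ((Finset.finite_toSet _).subset (conv_support β hK hL' n)))
    (fun c a b => ext fun n => by
      simp only [smul_coeff, map_smul]
      exact (smul_finsum _ _).symm)

theorem conv_coeff (β : M →ₗ[ℂ] N →ₗ[ℂ] P) (a : Lau M) (b : Lau N) (n : ℤ) :
    (conv β a b).1 n = ∑ᶠ c, β (a.1 c) (b.1 (n - c)) := rfl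

theorem conv_coeff_sum (β : M →ₗ[ℂ] N →ₗ[ℂ] P) {K L : ℤ} {a : Lau M} {b : Lau N}
    (ha : Ge K a) (hb : Ge L b) (n : ℤ) :
    (conv β a b).1 n = ∑ c ∈ Finset.Icc K (n - L), β (a.1 c) (b.1 (n - c)) :=
  finsum_eq_sum_of_support_subset _ (conv_support β ha hb n)

theorem Ge.conv (β : M →ₗ[ℂ] N →ₗ[ℂ] P) {K L : ℤ} {a : Lau M} {b : Lau N}
    (ha : Ge K a) (hb : Ge L b) : Ge (K + L) (conv β a b) := fun n hn => by
  rw [conv_coeff_sum β ha hb, Finset.Icc_eq_empty (by omega), Finset.sum_empty]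

theorem fil_conv_left (β : M →ₗ[ℂ] N →ₗ[ℂ] P) {L : ℤ} {b : Lau N} (hb : Ge L b) :
    Fil L ((conv β).flip b) := fun _ _ ha => ha.conv β hb

theorem fil_conv_right (β : M →ₗ[ℂ] N →ₗ[ℂ] P) {K : ℤ} {a : Lau M} (ha : Ge K a) :
    Fil K (conv β a) := fun L b hb => by
  rw [add_comm]; exact ha.conv β hb

theorem conv_single_left (β : M →ₗ[ℂ] N →ₗ[ℂ] P) (c : ℤ) (m : M) (b : Lau N) (n : ℤ) :
    (conv β (single c m) b).1 n = β m (b.1 (n - c)) := by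
  rw [conv_coeff, finsum_eq_single _ c]
  · simp [single_coeff]
  · intro d hd; simp [single_coeff, hd]

theorem conv_single_single (β : M →ₗ[ℂ] N →ₗ[ℂ] P) (c d : ℤ) (m : M) (m' : N) :
    conv β (single c m) (single d m') = single (c + d) (β m m') := by
  refine ext fun n => ?_
  rw [conv_single_left, single_coeff, single_coeff]
  by_cases h : n = c + d
  · simp [h]
  · rw [if_neg (by omega), if_neg h, map_zero]

/-- Apply a linear map to the coefficients of a Laurent series. -/
def map (f : M →ₗ[ℂ] N) : Lau M →ₗ[ℂ] Lau N where
  toFun a := ⟨fun n => f (a.1 n), by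
    obtain ⟨K, hK⟩ := exists_ge a
    exact ⟨K, fun n hn => by dsimp only; rw [hK n hn, map_zero]⟩⟩
  map_add' _ _ := ext fun n => by simp
  map_smul' _ _ := ext fun n => by simp

@[simp]
theorem map_coeff (f : M →ₗ[ℂ] N) (a : Lau M) (n : ℤ) : (map f a).1 n = f (a.1 n) := rfl

theorem fil_map (f : M →ₗ[ℂ] N) : Fil 0 (map f) := fun K a ha n hn => by
  rw [map_coeff, ha n (by omega), map_zero]

@[simp]
theorem map_single (f : M →ₗ[ℂ] N) (c : ℤ) (m : M) :
    map f (single c m) = single c (f m) :=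
  ext fun n => by rw [map_coeff, single_coeff, single_coeff]; split_ifs <;> simp

theorem conv_single_zero (β : M →ₗ[ℂ] N →ₗ[ℂ] P) (m : M) (b : Lau N) :
    conv β (single 0 m) b = map (β m) b :=
  ext fun n => by rw [conv_single_left, sub_zero, map_coeff]

theorem conv_flip (β : M →ₗ[ℂ] N →ₗ[ℂ] P) (a : Lau M) (b : Lau N) :
    conv β.flip b a = conv β a b := by
  obtain ⟨K, hK⟩ := exists_ge a
  obtain ⟨L, hL⟩ := exists_ge b
  refine hom_ext (F := conv β.flip b) (G := (conv β).flip b) (fil_conv_right _ hL)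
    (fil_conv_left _ hL) (fun c m => ?_) a
  refine hom_ext (F := (conv β.flip).flip (single c m)) (G := conv β (single c m))
    (fil_conv_left _ (ge_single c m)) (fil_conv_right _ (ge_single c m)) (fun d m' => ?_) b
  simp [conv_single_single, add_comm]

theorem conv_single_zero_right (β : M →ₗ[ℂ] N →ₗ[ℂ] P) (a : Lau M) (m : N) :
    conv β a (single 0 m) = map (β.flip m) a := by
  rw [← conv_flip, conv_single_zero]

theorem map_conv (Φ : P →ₗ[ℂ] Q) (β : M →ₗ[ℂ] N →ₗ[ℂ] P) (a : Lau M) (b : Lau N) :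
    map Φ (conv β a b) = conv (β.compr₂ Φ) a b := by
  refine ext fun n => ?_
  obtain ⟨K, hK⟩ := exists_ge a
  obtain ⟨L, hL⟩ := exists_ge b
  rw [map_coeff, conv_coeff_sum β hK hL, conv_coeff_sum _ hK hL, map_sum]
  rfl

theorem conv_map_map {M' N' : Type*} [AddCommGroup M'] [Module ℂ M'] [AddCommGroup N']
    [Module ℂ N'] (β : M →ₗ[ℂ] N →ₗ[ℂ] P) (f : M' →ₗ[ℂ] M) (g : N' →ₗ[ℂ] N)
    (a : Lau M') (b : Lau N') : conv β (map f a) (map g b) = conv (β.compl₁₂ f g) a b := rfl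

theorem conv_map_left {M' : Type*} [AddCommGroup M'] [Module ℂ M']
    (β : M →ₗ[ℂ] N →ₗ[ℂ] P) (f : M' →ₗ[ℂ] M)
    (a : Lau M') (b : Lau N) : conv β (map f a) b = conv (β ∘ₗ f) a b := rfl

theorem map_conv_of (Φ : P →ₗ[ℂ] Q) (β : M →ₗ[ℂ] N →ₗ[ℂ] P) {M' N' : Type*} [AddCommGroup M']
    [Module ℂ M'] [AddCommGroup N'] [Module ℂ N'] (β' : M' →ₗ[ℂ] N' →ₗ[ℂ] Q) (f : M →ₗ[ℂ] M')
    (g : N →ₗ[ℂ] N') (h : ∀ m n, Φ (β m n) = β' (f m) (g n)) (a : Lau M) (b : Lau N) :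
    map Φ (conv β a b) = conv β' (map f a) (map g b) := by
  have : β.compr₂ Φ = β'.compl₁₂ f g := LinearMap.ext₂ h
  rw [map_conv, conv_map_map, this]

theorem conv_assoc {X Y Z : Type*} [AddCommGroup X] [Module ℂ X] [AddCommGroup Y] [Module ℂ Y]
    [AddCommGroup Z] [Module ℂ Z]
    (β₁ : X →ₗ[ℂ] P →ₗ[ℂ] Z) (β₂ : M →ₗ[ℂ] N →ₗ[ℂ] X) (β₃ : M →ₗ[ℂ] Y →ₗ[ℂ] Z)
    (β₄ : N →ₗ[ℂ] P →ₗ[ℂ] Y) (h : ∀ m n p, β₁ (β₂ m n) p = β₃ m (β₄ n p))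
    (a : Lau M) (b : Lau N) (e : Lau P) :
    conv β₁ (conv β₂ a b) e = conv β₃ a (conv β₄ b e) := by
  obtain ⟨L, hL⟩ := exists_ge b
  obtain ⟨J, hJ⟩ := exists_ge e
  refine hom_ext (F := (conv β₁).flip e ∘ₗ (conv β₂).flip b) (G := (conv β₃).flip (conv β₄ b e))
    ((fil_conv_left _ hJ).comp (fil_conv_left _ hL)) (fil_conv_left _ (hL.conv _ hJ))
    (fun c m => ?_) a
  refine hom_ext (F := (conv β₁).flip e ∘ₗ conv β₂ (single c m))
    (G := conv β₃ (single c m) ∘ₗ (conv β₄).flip e)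
    ((fil_conv_left _ hJ).comp (fil_conv_right _ (ge_single c m)))
    ((fil_conv_right _ (ge_single c m)).comp (fil_conv_left _ hJ))
    (fun d n => ?_) b
  refine hom_ext (F := conv β₁ (conv β₂ (single c m) (single d n)))
    (G := conv β₃ (single c m) ∘ₗ conv β₄ (single d n))
    (fil_conv_right _ ((ge_single c m).conv _ (ge_single d n)))
    ((fil_conv_right _ (ge_single c m)).comp (fil_conv_right _ (ge_single d n)))
    (fun i p => ?_) e
  simp [conv_single_single, h, add_assoc]

theorem conv_left_comm {X Y Z : Type*} [AddCommGroup X] [Module ℂ X] [AddCommGroup Y] [Module ℂ Y]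
    [AddCommGroup Z] [Module ℂ Z]
    (β₁ : M →ₗ[ℂ] X →ₗ[ℂ] Z) (β₂ : N →ₗ[ℂ] P →ₗ[ℂ] X) (β₃ : N →ₗ[ℂ] Y →ₗ[ℂ] Z)
    (β₄ : M →ₗ[ℂ] P →ₗ[ℂ] Y) (h : ∀ m n p, β₁ m (β₂ n p) = β₃ n (β₄ m p))
    (a : Lau M) (b : Lau N) (e : Lau P) :
    conv β₁ a (conv β₂ b e) = conv β₃ b (conv β₄ a e) := by
  rw [← conv_flip β₁, ← conv_flip β₄]
  exact conv_assoc _ _ _ _ (fun n p m => h m n p) b e a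

end Lau

theorem zchoose_eq_choose (n : ℤ) (k : ℕ) : zchoose n k = Ring.choose n k := by
  unfold zchoose
  split_ifs with h
  · lift n to ℕ using h
    rw [Ring.choose_natCast, Int.toNat_natCast]
  · obtain ⟨m, rfl⟩ : ∃ m, n = -m := ⟨-n, by simp⟩
    rw [Ring.choose_neg', Units.smul_def, Int.coe_negOnePow_natCast, smul_eq_mul]
    have : (m + k - 1 : ℤ) = ((k - -m - 1 : ℤ).toNat : ℕ) := by omega
    rw [Ring.multichoose_eq, this, Ring.choose_natCast]

namespace Lau

variable {M N P : Type*} [AddCommGroup M] [Module ℂ M] [AddCommGroup N] [Module ℂ N]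
  [AddCommGroup P] [Module ℂ P]

/-- Multiplication of vectors by scalars. -/
abbrev sm (M : Type*) [AddCommGroup M] [Module ℂ M] : ℂ →ₗ[ℂ] M →ₗ[ℂ] M := LinearMap.lsmul ℂ M

/-- The divided power derivative of a Laurent series. -/
def hasse (i : ℕ) : Lau M →ₗ[ℂ] Lau M where
  toFun a := ⟨fun n => ((Ring.choose (n + i) i : ℤ) : ℂ) • a.1 (n + i), by
    obtain ⟨K, hK⟩ := exists_ge a
    exact ⟨K - i, fun n hn => by dsimp only; rw [hK _ (by omega), smul_zero]⟩⟩
  map_add' _ _ := ext fun n => by simp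
  map_smul' _ _ := ext fun n => smul_comm _ _ _

theorem hasse_coeff (i : ℕ) (a : Lau M) (n : ℤ) :
    (hasse i a).1 n = ((Ring.choose (n + i) i : ℤ) : ℂ) • a.1 (n + i) := rfl

theorem fil_hasse (i : ℕ) : Fil (-i) (hasse (M := M) i) := fun K a ha n hn => by
  rw [hasse_coeff, ha _ (by omega), smul_zero]

theorem hasse_single (i : ℕ) (c : ℤ) (m : M) :
    hasse i (single c m) = single (c - i) (((Ring.choose c i : ℤ) : ℂ) • m) := by
  refine ext fun n => ?_
  rw [hasse_coeff, single_coeff, single_coeff]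
  by_cases h : n = c - i
  · subst h; simp
  · rw [if_neg (by omega), if_neg h, smul_zero]

theorem hasse_zero (a : Lau M) : hasse 0 a = a := ext fun n => by
  simp [hasse_coeff]

theorem hasse_hasse (i j : ℕ) (a : Lau M) :
    hasse i (hasse j a) = ((i + j).choose i : ℂ) • hasse (i + j) a := by
  refine ext fun n => ?_
  rw [smul_coeff, hasse_coeff, hasse_coeff, hasse_coeff, smul_smul, smul_smul]
  have h := Ring.choose_smul_choose (n + i + j) (n := i + j) (k := j) (by omega)
  rw [Nat.add_sub_cancel, add_sub_cancel_right, nsmul_eq_mul] at h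
  have h' : (i + j).choose i = (i + j).choose j := Nat.choose_symm_add
  push_cast
  rw [← add_assoc, h', mul_comm]
  exact_mod_cast congrArg (fun z : ℤ => (z : ℂ) • a.1 (n + i + j)) h.symm

/-- The Taylor shift `∑ᵢ εⁱ xⁱ ∂⁽ⁱ⁾` as a series of operators. -/
def taylorEnd (ε : ℂ) : Lau (Lau M →ₗ[ℂ] Lau M) :=
  ⟨fun i => if 0 ≤ i then ε ^ i.toNat • hasse i.toNat else 0, 0, fun n hn => by
    dsimp only; rw [if_neg (by omega)]⟩

theorem taylorEnd_coeff_nat (ε : ℂ) (i : ℕ) :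
    (taylorEnd (M := M) ε).1 i = ε ^ i • hasse i := by
  simp [taylorEnd]

theorem ge_taylorEnd (ε : ℂ) : Ge 0 (taylorEnd (M := M) ε) := fun i hi => by
  simp [taylorEnd, hi]

/-- The operator `A(x₁, x₂) ↦ A(x₁ + ε x₂, x₂)` (outer variable `x₂`). -/
def taylorOp (ε : ℂ) : Lau (Lau M) →ₗ[ℂ] Lau (Lau M) := conv LinearMap.id (taylorEnd ε)

/-- The operator `a(x) ↦ a(x + ε y)` (outer variable `y`). -/
def taylor (ε : ℂ) : Lau M →ₗ[ℂ] Lau (Lau M) := taylorOp ε ∘ₗ single 0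

theorem fil_taylorOp (ε : ℂ) : Fil 0 (taylorOp (M := M) ε) := fil_conv_right _ (ge_taylorEnd ε)

theorem taylor_eq_map (ε : ℂ) (a : Lau M) :
    taylor ε a = map (LinearMap.applyₗ a) (taylorEnd ε) := by
  rw [taylor, LinearMap.comp_apply, taylorOp, conv_single_zero_right]
  rfl

theorem taylor_coeff_nat (ε : ℂ) (a : Lau M) (i : ℕ) :
    (taylor ε a).1 i = ε ^ i • hasse i a := by
  rw [taylor_eq_map, map_coeff, taylorEnd_coeff_nat]
  rfl

theorem ge_taylor (ε : ℂ) (a : Lau M) : Ge 0 (taylor ε a) := fun i hi => by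
  rw [taylor_eq_map, map_coeff, ge_taylorEnd ε i hi, map_zero]

theorem taylorOp_single (ε : ℂ) (c : ℤ) (a : Lau M) :
    taylorOp ε (single c a) = conv (sm _) (single c 1) (taylor ε a) := by
  have : single c a = conv (sm _) (single c 1) (single 0 a) := by
    simp [conv_single_single]
  rw [this, taylor, LinearMap.comp_apply, taylorOp,
    conv_left_comm _ _ (sm _) LinearMap.id (fun m n p => by simp)]

theorem sum_Icc_int {A : Type*} [AddCommMonoid A] (k : ℕ) (f : ℤ → A) :
    ∑ c ∈ Finset.Icc (0 : ℤ) k, f c = ∑ p ∈ Finset.HasAntidiagonal.antidiagonal k, f p.1 := by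
  symm
  refine Finset.sum_nbij' (fun p => (p.1 : ℤ)) (fun c => (c.toNat, k - c.toNat)) ?_ ?_ ?_ ?_ ?_
  · intro p hp; simp at hp ⊢; omega
  · intro c hc; simp at hc ⊢; omega
  · rintro ⟨p, q⟩ hp; simp at hp ⊢; omega
  · intro c hc; simp at hc ⊢; omega
  · intro p hp; rfl

theorem conv_coeff_antidiagonal (β : M →ₗ[ℂ] N →ₗ[ℂ] P) {a : Lau M} {b : Lau N}
    (ha : Ge 0 a) (hb : Ge 0 b) (k : ℕ) :
    (conv β a b).1 k = ∑ p ∈ Finset.HasAntidiagonal.antidiagonal k, β (a.1 p.1) (b.1 p.2) := by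
  rw [conv_coeff_sum β ha hb, sub_zero, sum_Icc_int]
  refine Finset.sum_congr rfl fun p hp => ?_
  rw [Finset.HasAntidiagonal.mem_antidiagonal] at hp
  rw [← hp, Nat.cast_add, add_sub_cancel_left]

theorem taylor_conv (β : M →ₗ[ℂ] N →ₗ[ℂ] P) (a : Lau M) (b : Lau N) :
    taylor 1 (conv β a b) = conv (conv β) (taylor 1 a) (taylor 1 b) := by
  refine ext fun i => ?_
  by_cases hi : i < 0
  · rw [ge_taylor _ _ i hi, ((ge_taylor 1 a).conv _ (ge_taylor 1 b)) i (by omega)]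
  lift i to ℕ using (by omega)
  rw [conv_coeff_antidiagonal _ (ge_taylor 1 a) (ge_taylor 1 b)]
  simp only [taylor_coeff_nat, one_pow, one_smul]
  obtain ⟨L, hL⟩ := exists_ge b
  have h1 : ∀ a b, hasse i (conv β a b) =
      (∑ p ∈ Finset.HasAntidiagonal.antidiagonal i, (conv β ∘ₗ hasse p.1).compl₂ (hasse p.2)) a b →
      hasse i (conv β a b) = ∑ p ∈ Finset.HasAntidiagonal.antidiagonal i, conv β (hasse p.1 a) (hasse p.2 b) := by
    intro a b h
    rw [h]
    simp [LinearMap.sum_apply]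
  apply h1
  set F := ∑ p ∈ Finset.HasAntidiagonal.antidiagonal i, (conv β ∘ₗ hasse p.1).compl₂ (hasse p.2) with hF
  have fil : ∀ K L a b, Ge K a → Ge L b → Ge (K + L - i) (F a b) := by
    intro K L a b ha hb n hn
    simp only [hF, LinearMap.sum_apply, sum_coeff]
    refine Finset.sum_eq_zero fun p hp => ?_
    rw [Finset.HasAntidiagonal.mem_antidiagonal] at hp
    exact (fil_hasse p.1 K a ha).conv β (fil_hasse p.2 L b hb) n (by omega)
  refine hom_ext (F := hasse i ∘ₗ (conv β).flip b) (G := F.flip b) (r := L + -i) (s := L - i)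
    ((fil_hasse i).comp (fil_conv_left _ hL)) (fun K a ha => ?_) (fun c m => ?_) a
  · have := fil K L a b ha hL
    rwa [add_sub_assoc] at this
  refine hom_ext (F := hasse i ∘ₗ conv β (single c m)) (G := F (single c m)) (r := c + -i)
    (s := c - i)
    ((fil_hasse i).comp (fil_conv_right _ (ge_single c m))) (fun K b hb => ?_) (fun d m' => ?_) b
  · have := fil c K _ b (ge_single c m) hb
    rwa [add_comm c, add_sub_assoc] at this
  simp only [hF, LinearMap.sum_apply, LinearMap.comp_apply, LinearMap.compl₂_apply,
    conv_single_single, hasse_single]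
  have h2 : ∀ p ∈ Finset.HasAntidiagonal.antidiagonal i,
      single (c - p.1 + (d - p.2)) (β (((Ring.choose c p.1 : ℤ) : ℂ) • m)
        (((Ring.choose d p.2 : ℤ) : ℂ) • m')) =
      (((Ring.choose c p.1 * Ring.choose d p.2 : ℤ) : ℂ)) • single (c + d - i) (β m m') := by
    intro p hp
    rw [Finset.HasAntidiagonal.mem_antidiagonal] at hp
    have : c - p.1 + (d - p.2) = c + d - i := by omega
    rw [this]
    simp [smul_smul, mul_comm]
  rw [Finset.sum_congr rfl h2, ← Finset.sum_smul, Ring.add_choose_eq _ (Commute.all c d)]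
  simp

theorem conv_sm_left {X Y Z : Type*} [AddCommGroup X] [Module ℂ X] [AddCommGroup Y] [Module ℂ Y]
    [AddCommGroup Z] [Module ℂ Z] (β : X →ₗ[ℂ] Y →ₗ[ℂ] Z) (f : Lau ℂ) (a : Lau X) (b : Lau Y) :
    conv β (conv (sm _) f a) b = conv (sm _) f (conv β a b) :=
  conv_assoc _ _ _ _ (fun m n p => by simp) f a b

theorem conv_sm_right {X Y Z : Type*} [AddCommGroup X] [Module ℂ X] [AddCommGroup Y] [Module ℂ Y]
    [AddCommGroup Z] [Module ℂ Z] (β : X →ₗ[ℂ] Y →ₗ[ℂ] Z) (f : Lau ℂ) (a : Lau X) (b : Lau Y) :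
    conv β a (conv (sm _) f b) = conv (sm _) f (conv β a b) :=
  conv_left_comm _ _ _ _ (fun m n p => by simp) a f b

theorem taylorOp_conv (β : M →ₗ[ℂ] N →ₗ[ℂ] P) (A : Lau (Lau M)) (B : Lau (Lau N)) :
    taylorOp 1 (conv (conv β) A B) = conv (conv β) (taylorOp 1 A) (taylorOp 1 B) := by
  obtain ⟨L, hL⟩ := exists_ge B
  refine hom_ext (F := taylorOp 1 ∘ₗ (conv (conv β)).flip B)
    (G := (conv (conv β)).flip (taylorOp 1 B) ∘ₗ taylorOp 1)
    ((fil_taylorOp 1).comp (fil_conv_left _ hL))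
    ((fil_conv_left _ (fil_taylorOp 1 _ _ hL)).comp (fil_taylorOp 1)) (fun c a => ?_) A
  refine hom_ext (F := taylorOp 1 ∘ₗ conv (conv β) (single c a))
    (G := conv (conv β) (taylorOp 1 (single c a)) ∘ₗ taylorOp 1)
    ((fil_taylorOp 1).comp (fil_conv_right _ (ge_single c a)))
    ((fil_conv_right _ (fil_taylorOp 1 _ _ (ge_single c a))).comp (fil_taylorOp 1))
    (fun d b => ?_) B
  rw [LinearMap.comp_apply, LinearMap.comp_apply, conv_single_single, taylorOp_single, taylor_conv,
    taylorOp_single, taylorOp_single, conv_sm_left, conv_sm_right, ← conv_sm_left (sm _),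
    conv_single_single, LinearMap.lsmul_apply, smul_eq_mul, one_mul]

theorem taylor_single_zero (ε : ℂ) (m : M) :
    taylor ε (single 0 m) = single 0 (single 0 m) := by
  refine ext fun i => ?_
  by_cases hi : i < 0
  · rw [ge_taylor _ _ i hi, ge_single _ _ i hi]
  lift i to ℕ using (by omega)
  rw [taylor_coeff_nat, hasse_single, single_coeff]
  rcases i with _ | i
  · simp
  · rw [if_neg (by omega), Ring.choose_zero_succ]
    simp

theorem taylorOp_map_single_zero (ε : ℂ) (h : Lau M) :
    taylorOp ε (map (single 0) h) = map (single 0) h := by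
  refine hom_ext (F := taylorOp ε ∘ₗ map (single 0)) (G := map (single 0))
    ((fil_taylorOp ε).comp (fil_map _)) (fil_map _) (fun c m => ?_) h
  rw [LinearMap.comp_apply, map_single, taylorOp_single, taylor_single_zero, conv_single_single]
  simp

theorem taylorOp_taylor_neg (a : Lau M) : taylorOp 1 (taylor (-1) a) = single 0 a := by
  refine ext fun i => ?_
  by_cases hi : i < 0
  · rw [ge_single _ _ i hi, fil_taylorOp 1 0 _ (ge_taylor _ a) i (by omega)]
  lift i to ℕ using (by omega)
  rw [taylorOp, conv_coeff_antidiagonal _ (ge_taylorEnd 1) (ge_taylor _ a)]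
  have h : ∀ p ∈ Finset.HasAntidiagonal.antidiagonal i,
      (LinearMap.id (R := ℂ) ((taylorEnd (M := M) 1).1 p.1)) ((taylor (-1) a).1 p.2) =
        ((-1 : ℂ) ^ p.2 * (i.choose p.1 : ℂ)) • hasse i a := by
    intro p hp
    rw [Finset.HasAntidiagonal.mem_antidiagonal] at hp
    rw [taylorEnd_coeff_nat, taylor_coeff_nat, one_pow, one_smul, LinearMap.id_apply,
      map_smul, hasse_hasse, hp, smul_smul]
  rw [Finset.sum_congr rfl h, ← Finset.sum_smul]
  have h2 := (Commute.all (1 : ℂ) (-1)).add_pow' i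
  simp only [one_pow, one_mul, nsmul_eq_mul] at h2
  simp only [mul_comm]
  rw [← h2, single_coeff]
  rcases i with _ | i
  · simp [hasse_zero]
  · have : ((i + 1 : ℕ) : ℤ) ≠ 0 := by omega
    simp only [add_neg_cancel, Nat.succ_ne_zero, zero_pow, ne_eq, not_false_eq_true, zero_smul]
    exact (if_neg this).symm

end Lau

namespace Lau

variable {M N P : Type*} [AddCommGroup M] [Module ℂ M] [AddCommGroup N] [Module ℂ N]
  [AddCommGroup P] [Module ℂ P]

/-- Multiplication by the variable. -/
def mulX : Lau M →ₗ[ℂ] Lau M := conv (sm M) (single 1 1)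

theorem mulX_coeff (a : Lau M) (n : ℤ) : (mulX a).1 n = a.1 (n - 1) := by
  rw [mulX, conv_single_left, LinearMap.lsmul_apply, one_smul]

theorem mulX_pow_coeff (k : ℕ) (a : Lau M) (n : ℤ) : ((mulX ^ k) a).1 n = a.1 (n - k) := by
  induction k generalizing n with
  | zero => simp
  | succ k ih =>
    rw [pow_succ', Module.End.mul_apply, mulX_coeff, ih, Nat.cast_succ]
    exact congrArg a.1 (by omega)

/-- Multiplication of a double series by the sum of its variables. -/
def addMul : Lau (Lau M) →ₗ[ℂ] Lau (Lau M) := mulX + map mulX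

theorem addMul_coeff (A : Lau (Lau M)) (n m : ℤ) :
    ((addMul A).1 n).1 m = (A.1 (n - 1)).1 m + (A.1 n).1 (m - 1) := by
  rw [addMul, LinearMap.add_apply, add_coeff, add_coeff, mulX_coeff, map_coeff, mulX_coeff]

theorem map_pow_apply (f : M →ₗ[ℂ] M) (k : ℕ) (a : Lau M) : (map f ^ k) a = map (f ^ k) a := by
  induction k with
  | zero => rfl
  | succ k ih => rw [pow_succ', Module.End.mul_apply, ih, pow_succ']; rfl

theorem commute_mulX_map : Commute (mulX (M := Lau M)) (map mulX) :=
  LinearMap.ext fun A => ext fun n => by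
    simp only [Module.End.mul_apply, mulX_coeff, map_coeff]

theorem addMul_pow_coeff (k : ℕ) (A : Lau (Lau M)) (n m : ℤ) :
    ((((addMul (M := M)) ^ k) A).1 n).1 m = mulAddPow k (fun m n => (A.1 n).1 m) m n := by
  rw [addMul, commute_mulX_map.add_pow, mulAddPow, LinearMap.sum_apply, sum_coeff, sum_coeff]
  refine Finset.sum_congr rfl fun j hj => ?_
  rw [Finset.mem_range] at hj
  rw [← nsmul_eq_mul', LinearMap.smul_apply, Module.End.mul_apply, map_pow_apply,
    ← Nat.cast_smul_eq_nsmul ℂ, smul_coeff, smul_coeff, mulX_pow_coeff, map_coeff, mulX_pow_coeff]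
  have : m - ((k - j : ℕ) : ℤ) = m - k + j := by omega
  rw [this]

theorem addMul_pow_coeff' (k : ℕ) (A : Lau (Lau M)) (n m : ℤ) :
    ((((addMul (M := M)) ^ k) A).1 n).1 m = mulAddPow k (fun n m => (A.1 n).1 m) n m := by
  rw [addMul, add_comm, commute_mulX_map.symm.add_pow, mulAddPow, LinearMap.sum_apply, sum_coeff,
    sum_coeff]
  refine Finset.sum_congr rfl fun j hj => ?_
  rw [Finset.mem_range] at hj
  rw [← nsmul_eq_mul', LinearMap.smul_apply, Module.End.mul_apply, map_pow_apply,
    ← Nat.cast_smul_eq_nsmul ℂ, smul_coeff, smul_coeff, map_coeff, mulX_pow_coeff, mulX_pow_coeff]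
  have : n - ((k - j : ℕ) : ℤ) = n - k + j := by omega
  rw [this]

theorem addMul_injective : Function.Injective (addMul (M := M)) := by
  rw [injective_iff_map_eq_zero]
  intro A hA
  obtain ⟨K, hK⟩ := exists_ge A
  have h : ∀ i : ℕ, A.1 (K - 1 + i) = 0 := by
    intro i
    induction i with
    | zero => exact hK _ (by simp)
    | succ i ih =>
      refine ext fun m => ?_
      have h2 := addMul_coeff A (K - 1 + (i + 1 : ℕ)) (m + 1)
      rw [hA] at h2
      have h3 : K - 1 + ((i + 1 : ℕ) : ℤ) - 1 = K - 1 + i := by push_cast; ring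
      rw [h3, ih] at h2
      simpa using h2.symm
  refine ext fun n => ?_
  by_cases hn : n < K
  · exact hK n hn
  · have := h (n - (K - 1)).toNat
    rw [Int.toNat_of_nonneg (by omega)] at this
    simpa using this

theorem addMul_pow_injective (k : ℕ) : Function.Injective ((addMul (M := M)) ^ k) := by
  rw [Module.End.coe_pow]
  exact addMul_injective.iterate k

theorem addMul_conv_left (β : M →ₗ[ℂ] N →ₗ[ℂ] P) (A : Lau (Lau M)) (B : Lau (Lau N)) :
    addMul (conv (conv β) A B) = conv (conv β) (addMul A) B := by
  simp only [addMul, LinearMap.add_apply, map_add]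
  congr 1
  · exact (conv_sm_left _ _ _ _).symm
  · exact map_conv_of mulX (conv β) (conv β) mulX LinearMap.id
      (fun m n => (conv_sm_left _ _ _ _).symm) A B

theorem addMul_conv_right (β : M →ₗ[ℂ] N →ₗ[ℂ] P) (A : Lau (Lau M)) (B : Lau (Lau N)) :
    addMul (conv (conv β) A B) = conv (conv β) A (addMul B) := by
  simp only [addMul, LinearMap.add_apply, map_add]
  congr 1
  · exact (conv_sm_right _ _ _ _).symm
  · exact map_conv_of mulX (conv β) (conv β) LinearMap.id mulX
      (fun m n => (conv_sm_right _ _ _ _).symm) A B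

theorem addMul_pow_conv (β : M →ₗ[ℂ] N →ₗ[ℂ] P) (k l : ℕ) (A : Lau (Lau M)) (B : Lau (Lau N)) :
    (addMul ^ (k + l)) (conv (conv β) A B) = conv (conv β) ((addMul ^ k) A) ((addMul ^ l) B) := by
  induction k with
  | zero =>
    induction l with
    | zero => rfl
    | succ l ih =>
      rw [← add_assoc, pow_succ', Module.End.mul_apply, ih, pow_succ' _ l, Module.End.mul_apply,
        addMul_conv_right]
  | succ k ih =>
    rw [add_right_comm, pow_succ', Module.End.mul_apply, ih, pow_succ' _ k, Module.End.mul_apply,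
      addMul_conv_left]

/-- Two iterated series agree after exchanging the roles of the variables. -/
def Tr (A B : Lau (Lau M)) : Prop := ∀ a b, (A.1 b).1 a = (B.1 a).1 b

theorem Tr.addMul {A B : Lau (Lau M)} (h : Tr A B) : Tr (addMul A) (addMul B) := fun a b => by
  rw [addMul_coeff, addMul_coeff, h, h, add_comm]

theorem Tr.addMul_pow {A B : Lau (Lau M)} (h : Tr A B) (k : ℕ) :
    Tr ((Lau.addMul ^ k) A) ((Lau.addMul ^ k) B) := by
  induction k with
  | zero => exact h
  | succ k ih => rw [pow_succ']; exact ih.addMul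

theorem Tr.add {A B A' B' : Lau (Lau M)} (h : Tr A B) (h' : Tr A' B') :
    Tr (A + A') (B + B') := fun a b => by
  simp only [add_coeff, h a b, h' a b]

theorem Tr.conv (β : M →ₗ[ℂ] N →ₗ[ℂ] P) {A B : Lau (Lau M)} {A' B' : Lau (Lau N)}
    (h : Tr A B) (h' : Tr A' B') : Tr (conv (conv β) A A') (conv (conv β) B B') := fun a b => by
  obtain ⟨K, hK⟩ := exists_ge A
  obtain ⟨L, hL⟩ := exists_ge B
  obtain ⟨K', hK'⟩ := exists_ge A'
  obtain ⟨L', hL'⟩ := exists_ge B'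
  have gA : ∀ c, Ge L (A.1 c) := fun c n hn => by rw [h, hL n hn]; rfl
  have gB : ∀ c, Ge K (B.1 c) := fun c n hn => by rw [← h, hK n hn]; rfl
  have gA' : ∀ c, Ge L' (A'.1 c) := fun c n hn => by rw [h', hL' n hn]; rfl
  have gB' : ∀ c, Ge K' (B'.1 c) := fun c n hn => by rw [← h', hK' n hn]; rfl
  rw [conv_coeff_sum _ hK hK', conv_coeff_sum _ hL hL', sum_coeff, sum_coeff]
  rw [Finset.sum_congr rfl fun c _ => conv_coeff_sum β (gA c) (gA' (b - c)) a,
    Finset.sum_congr rfl fun c _ => conv_coeff_sum β (gB c) (gB' (a - c)) b, Finset.sum_comm]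
  simp only [h _ _, h' _ _]

/-- The formal analogue of `A(x₀ + x₂, x₂) = B(x₀, x₂)` up to a power of `x₀ + x₂`. The outer
variable is `x₂` for `A` and `x₀` for `B`. -/
def WA (A B : Lau (Lau M)) : Prop := ∃ k : ℕ, Tr ((addMul ^ k) (taylorOp 1 A)) ((addMul ^ k) B)

theorem Tr.addMul_pow_le {A B : Lau (Lau M)} {k l : ℕ}
    (h : Tr ((Lau.addMul ^ k) A) ((Lau.addMul ^ k) B)) (hl : k ≤ l) :
    Tr ((Lau.addMul ^ l) A) ((Lau.addMul ^ l) B) := by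
  obtain ⟨d, rfl⟩ := Nat.exists_eq_add_of_le' hl
  rw [pow_add]
  exact h.addMul_pow d

theorem WA.zero : WA (0 : Lau (Lau M)) 0 := ⟨0, fun a b => by simp⟩

theorem WA.add {A B A' B' : Lau (Lau M)} (h : WA A B) (h' : WA A' B') :
    WA (A + A') (B + B') := by
  obtain ⟨k, hk⟩ := h
  obtain ⟨k', hk'⟩ := h'
  refine ⟨max k k', ?_⟩
  simp only [map_add]
  exact (hk.addMul_pow_le (le_max_left _ _)).add (hk'.addMul_pow_le (le_max_right _ _))

theorem WA.conv (β : M →ₗ[ℂ] N →ₗ[ℂ] P) {A B : Lau (Lau M)} {A' B' : Lau (Lau N)}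
    (h : WA A B) (h' : WA A' B') : WA (conv (conv β) A A') (conv (conv β) B B') := by
  obtain ⟨k, hk⟩ := h
  obtain ⟨k', hk'⟩ := h'
  refine ⟨k + k', ?_⟩
  rw [taylorOp_conv, addMul_pow_conv, addMul_pow_conv]
  exact hk.conv β hk'

theorem WA.unique {A B B' : Lau (Lau M)} (h : WA A B) (h' : WA A B') : B = B' := by
  obtain ⟨k, hk⟩ := h
  obtain ⟨k', hk'⟩ := h'
  refine addMul_pow_injective (max k k') (ext fun a => ext fun b => ?_)
  rw [← hk.addMul_pow_le (le_max_left _ _), hk'.addMul_pow_le (le_max_right _ _)]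

theorem WA.taylor_neg (φ : Lau M) : WA (taylor (-1) φ) (map (single 0) φ) :=
  ⟨0, fun a b => by
    rw [taylorOp_taylor_neg]
    simp only [pow_zero, Module.End.one_apply, map_coeff, single_coeff]
    split_ifs <;> rfl⟩

theorem WA.map_single (h : Lau M) : WA (map (single 0) h) (single 0 h) :=
  ⟨0, fun a b => by
    rw [taylorOp_map_single_zero]
    simp only [pow_zero, Module.End.one_apply, map_coeff, single_coeff]
    split_ifs <;> rfl⟩

theorem taylor_single_one : taylor 1 (single 1 (1 : ℂ)) =
    single 0 (single 1 1) + single 1 (single 0 1) := by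
  refine ext fun i => ?_
  by_cases hi : i < 0
  · rw [ge_taylor _ _ i hi, add_coeff, ge_single _ _ i hi, ge_single _ _ i (by omega), add_zero]
  lift i to ℕ using (by omega)
  rw [taylor_coeff_nat, one_pow, one_smul, hasse_single, add_coeff, single_coeff 0,
    single_coeff 1 (single 0 1)]
  have hc : (Ring.choose (1 : ℤ) i) = ((1 : ℕ).choose i : ℕ) := by
    rw [← Ring.choose_natCast]; rfl
  rw [hc]
  rcases i with _ | _ | i
  · simp
  · simp
  · have h1 : ((i + 1 + 1 : ℕ) : ℤ) ≠ 0 := by omega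
    have h2 : ((i + 1 + 1 : ℕ) : ℤ) ≠ 1 := by omega
    rw [if_neg h1, if_neg h2, Nat.choose_eq_zero_of_lt (by omega)]
    simp

theorem addMul_taylor (g : Lau M) : addMul (taylor 1 g) = taylor 1 (mulX g) := by
  rw [mulX, taylor_conv, taylor_single_one, map_add, LinearMap.add_apply, conv_single_zero, addMul,
    LinearMap.add_apply, add_comm]
  congr 1
  refine ext fun n => ?_
  rw [mulX_coeff, conv_single_left, conv_single_zero]
  exact ext fun m => (one_smul ℂ _).symm

theorem addMul_pow_taylor (k : ℕ) (g : Lau M) :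
    (addMul ^ k) (taylor 1 g) = taylor 1 ((mulX ^ k) g) := by
  induction k with
  | zero => rfl
  | succ k ih => rw [pow_succ', Module.End.mul_apply, ih, addMul_taylor, pow_succ']; rfl

theorem taylor_coeff_of_neg {f : Lau M} (hf : Ge 0 f) {a b : ℤ} (hb : b < 0) :
    ((taylor 1 f).1 a).1 b = 0 := by
  by_cases ha : a < 0
  · rw [ge_taylor _ _ a ha]; rfl
  lift a to ℕ using (by omega)
  rw [taylor_coeff_nat, one_pow, one_smul, hasse_coeff]
  by_cases h : b + a < 0
  · rw [hf _ h, smul_zero]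
  · obtain ⟨d, hd⟩ := Int.eq_ofNat_of_zero_le (not_lt.1 h)
    rw [hd, Ring.choose_natCast, Nat.choose_eq_zero_of_lt (by omega)]
    simp

theorem Tr.taylor_self {f : Lau M} (hf : Ge 0 f) : Tr (taylor 1 f) (taylor 1 f) := fun a b => by
  by_cases ha : a < 0
  · rw [taylor_coeff_of_neg hf ha, ge_taylor _ _ a ha]; rfl
  by_cases hb : b < 0
  · rw [taylor_coeff_of_neg hf hb, ge_taylor _ _ b hb]; rfl
  lift a to ℕ using (by omega)
  lift b to ℕ using (by omega)
  simp only [taylor_coeff_nat, one_pow, one_smul, hasse_coeff]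
  rw [add_comm (b : ℤ), ← Nat.cast_add, Ring.choose_natCast, Ring.choose_natCast,
    Nat.choose_symm_add]

theorem WA.taylor (g : Lau M) : WA (single 0 g) (taylor 1 g) := by
  obtain ⟨K, hK⟩ := exists_ge g
  refine ⟨(-K).toNat, ?_⟩
  change Tr ((addMul ^ _) (Lau.taylor 1 g)) _
  rw [addMul_pow_taylor]
  refine Tr.taylor_self fun n hn => ?_
  rw [mulX_pow_coeff, hK _ (by omega)]

theorem taylorOp_coeff (A : Lau (Lau M)) (a b : ℤ) :
    ((taylorOp 1 A).1 b).1 a = substAdd02 (fun m n => (A.1 n).1 m) a b := by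
  obtain ⟨L, hL⟩ := exists_ge A
  rw [taylorOp, substAdd02, conv_coeff_sum _ (ge_taylorEnd 1) hL, sum_coeff]
  by_cases hb : b - L < 0
  · rw [Finset.Icc_eq_empty (by omega), Finset.sum_empty]
    refine (finsum_eq_zero_of_forall_eq_zero fun i => ?_).symm
    rw [hL _ (by omega), zero_coeff, smul_zero]
  obtain ⟨N, hN⟩ := Int.eq_ofNat_of_zero_le (not_lt.1 hb)
  rw [hN, sum_Icc_int, Finset.Nat.sum_antidiagonal_eq_sum_range_succ_mk,
    finsum_eq_sum_of_support_subset (s := Finset.range N.succ)]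
  · refine Finset.sum_congr rfl fun i _ => ?_
    rw [taylorEnd_coeff_nat, one_pow, one_smul, LinearMap.id_apply, hasse_coeff, zchoose_eq_choose]
  · intro i hi
    by_contra h
    rw [Finset.coe_range, Set.mem_Iio] at h
    refine hi ?_
    dsimp only
    rw [hL (b - i) (by omega), zero_coeff, smul_zero]

theorem wa_iff (A B : Lau (Lau M)) : WA A B ↔ ∃ k : ℕ, ∀ a b : ℤ,
    mulAddPow k (substAdd02 fun m n => (A.1 n).1 m) a b = mulAddPow k (fun a b => (B.1 a).1 b) a b := by
  refine exists_congr fun k => forall_congr' fun a => forall_congr' fun b => ?_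
  rw [addMul_pow_coeff, addMul_pow_coeff']
  simp only [taylorOp_coeff]

end Lau

namespace Lau

variable {M N P Q U : Type*} [AddCommGroup M] [Module ℂ M] [AddCommGroup N] [Module ℂ N]
  [AddCommGroup P] [Module ℂ P] [AddCommGroup Q] [Module ℂ Q] [AddCommGroup U] [Module ℂ U]

/-- A bilinear map to formal series with Laurent values, as a map to Laurent series. -/
def bundle (Y : M →ₗ[ℂ] N →ₗ[ℂ] (ℤ → P)) (h : ∀ a b, IsLaurent (Y a b)) :
    M →ₗ[ℂ] N →ₗ[ℂ] Lau P :=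
  LinearMap.mk₂ ℂ (fun a b => ⟨Y a b, h a b⟩)
    (fun a a' b => Subtype.ext (by simp)) (fun c a b => Subtype.ext (by simp))
    (fun a b b' => Subtype.ext (by simp)) (fun c a b => Subtype.ext (by simp))

/-- `map` as a linear map in the function. -/
def mapHom : (M →ₗ[ℂ] N) →ₗ[ℂ] Lau M →ₗ[ℂ] Lau N where
  toFun := map
  map_add' _ _ := rfl
  map_smul' _ _ := rfl

theorem mapHom_apply (f : M →ₗ[ℂ] N) : mapHom f = map f := rfl

theorem map_conv_sm (f : M →ₗ[ℂ] N) (g : Lau ℂ) (a : Lau M) :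
    map f (conv (sm M) g a) = conv (sm N) g (map f a) :=
  map_conv_of f (sm M) (sm N) LinearMap.id f (fun c m => by simp) g a

theorem conv_sm_eq (g : Lau ℂ) (A : Lau (Lau M)) :
    conv (sm (Lau M)) g A = conv (conv (sm M)) (map (single 0) g) A := by
  have : sm (Lau M) = conv (sm M) ∘ₗ single 0 := LinearMap.ext₂ fun c x =>
    (conv_single_zero (sm M) c x).symm
  rw [conv_map_left, this]

/-- The map `U ⊗ ℂ((x)) → U((x))`. -/
def ofTensor : U ⊗[ℂ] Lau ℂ →ₗ[ℂ] Lau U :=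
  TensorProduct.lift ((conv (sm U)).flip ∘ₗ single 0)

theorem ofTensor_tmul (u : U) (g : Lau ℂ) :
    ofTensor (u ⊗ₜ[ℂ] g) = conv (sm U) g (single 0 u) := rfl

theorem ofTensor_coeff (u : U) (g : Lau ℂ) (n : ℤ) : (ofTensor (u ⊗ₜ[ℂ] g)).1 n = g.1 n • u := by
  rw [ofTensor_tmul, conv_single_zero_right]
  rfl

theorem ofTensor_injective : Function.Injective (ofTensor (U := U)) := by
  classical
  let b := Module.Basis.ofVectorSpace ℂ U
  have key : ∀ (t : U ⊗[ℂ] Lau ℂ) i,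
      TensorProduct.equivFinsuppOfBasisLeft b t i = map (b.coord i) (ofTensor t) := by
    intro t i
    induction t with
    | zero => simp
    | add s t hs ht => rw [map_add, Finsupp.add_apply, hs, ht, map_add, map_add]
    | tmul u g =>
      rw [TensorProduct.equivFinsuppOfBasisLeft_apply_tmul_apply]
      refine ext fun n => ?_
      rw [map_coeff, ofTensor_coeff, smul_coeff, map_smul, smul_eq_mul, smul_eq_mul, mul_comm]
      rfl
  intro s t h
  refine (TensorProduct.equivFinsuppOfBasisLeft b).injective (Finsupp.ext fun i => ?_)
  rw [key, key, h]

theorem mem_range_ofTensor {a : Lau U} (h : IsTensorLaurent a.1) :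
    a ∈ LinearMap.range (ofTensor (U := U)) := by
  obtain ⟨-, F, hF, ha⟩ := h
  have : Module.Finite ℂ F := Module.Finite.of_fg hF
  let b := Module.finBasis ℂ F
  let a' : Lau F := ⟨fun n => ⟨a.1 n, ha n⟩, by
    obtain ⟨K, hK⟩ := exists_ge a
    exact ⟨K, fun n hn => Subtype.ext (hK n hn)⟩⟩
  refine ⟨∑ i, (b i : U) ⊗ₜ[ℂ] map (b.coord i) a', ext fun n => ?_⟩
  rw [map_sum, sum_coeff]
  simp only [ofTensor_coeff, map_coeff]
  have h2 := congrArg F.subtype (b.sum_repr (a'.1 n))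
  rw [map_sum] at h2
  exact h2

/-- Extend the second argument of a bilinear map `ℂ((x))`-linearly. -/
def extend (F : M →ₗ[ℂ] U →ₗ[ℂ] Lau P) : M →ₗ[ℂ] U ⊗[ℂ] Lau ℂ →ₗ[ℂ] Lau P :=
  TensorProduct.uncurry (.id ℂ) U (Lau ℂ) (Lau P) ∘ₗ
    LinearMap.llcomp ℂ U (Lau P) (Lau ℂ →ₗ[ℂ] Lau P) (conv (sm P)).flip ∘ₗ F

theorem extend_tmul (F : M →ₗ[ℂ] U →ₗ[ℂ] Lau P) (m : M) (u : U) (g : Lau ℂ) :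
    extend F m (u ⊗ₜ[ℂ] g) = conv (sm P) g (F m u) := rfl

/-- The map `(e ⊗ φ) ⊗ (w ⊗ g) ↦ Y(e, x₂) w φ(x₁ - x₂) g(x₁)` (outer variable `x₂`). -/
def shiftMul (Y : U →ₗ[ℂ] U →ₗ[ℂ] Lau U) :
    U ⊗[ℂ] Lau ℂ →ₗ[ℂ] U ⊗[ℂ] Lau ℂ →ₗ[ℂ] Lau (U ⊗[ℂ] Lau ℂ) :=
  (TensorProduct.map₂ Y ((conv (conv (sm ℂ))).compl₁₂ (taylor (-1)) (single 0))).compr₂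
    (TensorProduct.lift (conv (TensorProduct.mk ℂ U (Lau ℂ))))

theorem shiftMul_tmul (Y : U →ₗ[ℂ] U →ₗ[ℂ] Lau U) (e w : U) (φ g : Lau ℂ) :
    shiftMul Y (e ⊗ₜ[ℂ] φ) (w ⊗ₜ[ℂ] g) = conv (TensorProduct.mk ℂ U (Lau ℂ)) (Y e w)
      (conv (conv (sm ℂ)) (taylor (-1) φ) (single 0 g)) := rfl

/-- The map `(w ⊗ g) ⊗ h ↦ w g(x₂ + x₀) h(x₂)` (outer variable `x₀`). -/
def taylorMul : U ⊗[ℂ] Lau ℂ →ₗ[ℂ] Lau ℂ →ₗ[ℂ] Lau (U ⊗[ℂ] Lau ℂ) :=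
  TensorProduct.lift
    ((LinearMap.llcomp ℂ (Lau ℂ) (Lau (Lau ℂ)) (Lau (U ⊗[ℂ] Lau ℂ)) ∘ₗ
      conv (TensorProduct.mk ℂ U (Lau ℂ)) ∘ₗ single 0).compl₂
        ((conv (conv (sm ℂ))).compl₁₂ (taylor 1) (single 0)))

theorem taylorMul_tmul (w : U) (g h : Lau ℂ) :
    taylorMul (w ⊗ₜ[ℂ] g) h = map (TensorProduct.mk ℂ U (Lau ℂ) w)
      (conv (conv (sm ℂ)) (taylor 1 g) (single 0 h)) := by
  rw [← conv_single_zero]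
  rfl

theorem WA.single_single (u : U) : WA (single 0 (single 0 u)) (single 0 (single 0 u)) := by
  have := WA.map_single (single 0 u)
  rwa [Lau.map_single] at this

theorem conv_conv_sm_assoc (f g : Lau (Lau ℂ)) (A : Lau (Lau M)) :
    conv (conv (sm M)) (conv (conv (sm ℂ)) f g) A =
      conv (conv (sm M)) f (conv (conv (sm M)) g A) :=
  conv_assoc _ _ _ _ (conv_assoc _ _ _ _ fun a b m => mul_smul a b m) f g A

theorem conv_conv_sm_comm (f g : Lau (Lau ℂ)) (A : Lau (Lau M)) :
    conv (conv (sm M)) f (conv (conv (sm M)) g A) =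
      conv (conv (sm M)) g (conv (conv (sm M)) f A) :=
  conv_left_comm _ _ _ _ (conv_left_comm _ _ _ _ fun a b m => smul_comm a b m) f g A

theorem WA.taylorMul (t : U ⊗[ℂ] Lau ℂ) (h : Lau ℂ) :
    WA (Lau.conv (sm (Lau U)) h (single 0 (ofTensor t))) (map ofTensor (taylorMul t h)) := by
  induction t with
  | zero => simpa using WA.zero
  | add s t hs ht =>
    simp only [map_add, LinearMap.add_apply]
    exact hs.add ht
  | tmul w g =>
    have e1 : Lau.conv (sm (Lau U)) h (single 0 (ofTensor (w ⊗ₜ[ℂ] g))) =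
        Lau.conv (Lau.conv (sm U)) (Lau.conv (Lau.conv (sm ℂ)) (single 0 g) (map (single 0) h))
          (single 0 (single 0 w)) := by
      rw [conv_sm_eq, ofTensor_tmul, conv_conv_sm_assoc, conv_conv_sm_comm, conv_single_single,
        add_zero]
    have e2 : map ofTensor (Lau.taylorMul (w ⊗ₜ[ℂ] g) h) =
        Lau.conv (Lau.conv (sm U)) (Lau.conv (Lau.conv (sm ℂ)) (Lau.taylor 1 g) (single 0 h))
          (single 0 (single 0 w)) := by
      rw [taylorMul_tmul, conv_single_zero_right (Lau.conv (sm U))]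
      rfl
    rw [e1, e2]
    exact ((WA.taylor g).conv _ (WA.map_single h)).conv _ (WA.single_single w)

/-- The scalar factors in the two iterated products of a smash product match. -/
theorem WA.shiftMul (Y : U →ₗ[ℂ] U →ₗ[ℂ] Lau U)
    (hY : ∀ u v w, WA (map (Y u) (Y v w)) (map (Y.flip w) (Y u v))) (u : U)
    (s t : U ⊗[ℂ] Lau ℂ) (h : Lau ℂ) :
    WA (Lau.conv (sm (Lau U)) h (map (extend Y u) (shiftMul Y s t)))
      (Lau.conv (extend Y) (extend Y u s) (Lau.taylorMul t h)) := by
  induction s with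
  | zero => simpa using WA.zero
  | add s s' hs hs' =>
    simp only [map_add, LinearMap.add_apply]
    exact hs.add hs'
  | tmul e φ =>
    induction t with
    | zero => simpa using WA.zero
    | add t t' ht ht' =>
      simp only [map_add, LinearMap.add_apply]
      exact ht.add ht'
    | tmul w g =>
      have e1 : Lau.conv (sm (Lau U)) h
            (map (extend Y u) (Lau.shiftMul Y (e ⊗ₜ[ℂ] φ) (w ⊗ₜ[ℂ] g))) =
          Lau.conv (Lau.conv (sm U)) (single 0 g) (Lau.conv (Lau.conv (sm U)) (map (single 0) h)
            (Lau.conv (Lau.conv (sm U)) (Lau.taylor (-1) φ) (map (Y u) (Y e w)))) := by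
        rw [conv_sm_eq, shiftMul_tmul,
          map_conv_of _ _ (Lau.conv (sm U)).flip (Y u) LinearMap.id (fun p k => extend_tmul Y u p k),
          conv_flip]
        change Lau.conv _ _ (Lau.conv _ (Lau.conv (Lau.conv (sm ℂ)) _ _) _) = _
        rw [conv_conv_sm_assoc, conv_conv_sm_comm (Lau.taylor _ _),
          conv_conv_sm_comm (map (single 0) h)]
      have e2 : Lau.conv (extend Y) (extend Y u (e ⊗ₜ[ℂ] φ)) (Lau.taylorMul (w ⊗ₜ[ℂ] g) h) =
          Lau.conv (Lau.conv (sm U)) (Lau.taylor 1 g) (Lau.conv (Lau.conv (sm U)) (single 0 h)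
            (Lau.conv (Lau.conv (sm U)) (map (single 0) φ) (map (Y.flip w) (Y u e)))) := by
        rw [taylorMul_tmul, extend_tmul, ← conv_conv_sm_assoc, ← conv_sm_eq, ← map_conv_sm,
          ← conv_flip (Lau.conv (sm U))]
        rfl
      rw [e1, e2]
      exact (WA.taylor g).conv _ ((WA.map_single h).conv _ ((WA.taylor_neg φ).conv _ (hY u e w)))

end Lau

namespace Lau

variable {M N P Q U : Type*} [AddCommGroup M] [Module ℂ M] [AddCommGroup N] [Module ℂ N]
  [AddCommGroup P] [Module ℂ P] [AddCommGroup Q] [Module ℂ Q] [AddCommGroup U] [Module ℂ U]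

/-- Factor a bilinear map with values in `U ⊗ ℂ((x)) ⊆ U((x))` through `U ⊗ ℂ((x))`. -/
def factor (F : M →ₗ[ℂ] N →ₗ[ℂ] Lau U) (hF : ∀ m n, IsTensorLaurent (F m n).1) :
    M →ₗ[ℂ] N →ₗ[ℂ] U ⊗[ℂ] Lau ℂ :=
  LinearMap.mk₂ ℂ
    (fun m n => (LinearEquiv.ofInjective ofTensor ofTensor_injective).symm
      ⟨F m n, mem_range_ofTensor (hF m n)⟩)
    (fun _ _ _ => ofTensor_injective (by simp only [map_add, LinearEquiv.ofInjective_symm_apply]; rfl))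
    (fun _ _ _ => ofTensor_injective (by simp only [map_smul, LinearEquiv.ofInjective_symm_apply]; rfl))
    (fun _ _ _ => ofTensor_injective (by simp only [map_add, LinearEquiv.ofInjective_symm_apply]))
    (fun _ _ _ => ofTensor_injective (by simp only [map_smul, LinearEquiv.ofInjective_symm_apply]))

theorem ofTensor_factor (F : M →ₗ[ℂ] N →ₗ[ℂ] Lau U) (hF : ∀ m n, IsTensorLaurent (F m n).1)
    (m : M) (n : N) : ofTensor (factor F hF m n) = F m n := by
  simp only [factor, LinearMap.mk₂_apply, LinearEquiv.ofInjective_symm_apply]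

theorem map_injective {f : M →ₗ[ℂ] N} (hf : Function.Injective f) : Function.Injective (map f) :=
  fun _ _ h => ext fun n => hf (congrArg (fun c => c.1 n) h)

/-- The coefficient of `x₂^(n - l)` in a shifted product, with `l` derivatives on the left. -/
def shiftTerm (Yn : U →ₗ[ℂ] U →ₗ[ℂ] U) (m : ℤ) (i : ℕ) : Lau U →ₗ[ℂ] Lau U →ₗ[ℂ] U :=
  (-1 : ℂ) ^ i • ((conv Yn ∘ₗ hasse i).compr₂ (LinearMap.proj m ∘ₗ Submodule.subtype _))

theorem shiftTerm_apply (Yn : U →ₗ[ℂ] U →ₗ[ℂ] U) (m : ℤ) (i : ℕ) (a b : Lau U) :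
    shiftTerm Yn m i a b = (-1 : ℂ) ^ i • (conv Yn (hasse i a) b).1 m := rfl

theorem hasse_ofTensor (i : ℕ) (e : U) (φ : Lau ℂ) :
    hasse i (ofTensor (e ⊗ₜ[ℂ] φ)) = ofTensor (e ⊗ₜ[ℂ] hasse i φ) :=
  ext fun n => by
    rw [hasse_coeff, ofTensor_coeff, ofTensor_coeff, hasse_coeff, smul_smul, smul_eq_mul]

theorem conv_ofTensor (β : M →ₗ[ℂ] U →ₗ[ℂ] P) (e : M) (φ : Lau ℂ) (w : U) (g : Lau ℂ) :
    conv β (ofTensor (e ⊗ₜ[ℂ] φ)) (ofTensor (w ⊗ₜ[ℂ] g)) =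
      ofTensor (β e w ⊗ₜ[ℂ] conv (sm ℂ) φ g) := by
  rw [ofTensor_tmul, ofTensor_tmul, ofTensor_tmul, conv_sm_left, conv_sm_right,
    conv_single_single, add_zero, conv_sm_left]

theorem shiftMul_coeff (Y : U →ₗ[ℂ] U →ₗ[ℂ] Lau U) (s t : U ⊗[ℂ] Lau ℂ) (n m : ℤ) :
    ∃ N₀, ∀ N ≥ N₀, ((map ofTensor (shiftMul Y s t)).1 n).1 m = ∑ i ∈ Finset.range N,
      shiftTerm (Y.compr₂ (LinearMap.proj (n - i) ∘ₗ Submodule.subtype _)) m i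
        (ofTensor s) (ofTensor t) := by
  induction s with
  | zero => exact ⟨0, fun N _ => by simp⟩
  | add s s' hs hs' =>
    obtain ⟨N₁, h₁⟩ := hs
    obtain ⟨N₂, h₂⟩ := hs'
    refine ⟨max N₁ N₂, fun N hN => ?_⟩
    simp only [map_add, LinearMap.add_apply, add_coeff, Finset.sum_add_distrib]
    rw [h₁ N (le_trans (le_max_left _ _) hN), h₂ N (le_trans (le_max_right _ _) hN)]
  | tmul e φ =>
    induction t with
    | zero => exact ⟨0, fun N _ => by simp⟩
    | add t t' ht ht' =>
      obtain ⟨N₁, h₁⟩ := ht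
      obtain ⟨N₂, h₂⟩ := ht'
      refine ⟨max N₁ N₂, fun N hN => ?_⟩
      simp only [map_add, add_coeff, Finset.sum_add_distrib]
      rw [h₁ N (le_trans (le_max_left _ _) hN), h₂ N (le_trans (le_max_right _ _) hN)]
    | tmul w g =>
      obtain ⟨K, hK⟩ := exists_ge (Y e w)
      refine ⟨(n - K + 1).toNat + 1, fun N hN => ?_⟩
      obtain ⟨N, rfl⟩ : ∃ N', N = N' + 1 := ⟨N - 1, by omega⟩
      have hX : Ge 0 (conv (conv (sm ℂ)) (taylor (-1) φ) (single 0 g)) :=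
        (ge_taylor _ _).conv _ (ge_single 0 g)
      have hY : Ge (n - N) (Y e w) := hK.mono (by omega)
      rw [shiftMul_tmul, map_conv, ← conv_flip, conv_coeff_sum _ hX hY, sub_sub_cancel, sum_Icc_int,
        Finset.Nat.sum_antidiagonal_eq_sum_range_succ_mk, sum_coeff]
      refine Finset.sum_congr rfl fun i _ => ?_
      rw [shiftTerm_apply, hasse_ofTensor, conv_ofTensor, ofTensor_coeff, conv_single_zero_right,
        map_coeff, taylor_coeff_nat, map_smul, LinearMap.flip_apply, LinearMap.compr₂_apply]
      change (ofTensor (_ ⊗ₜ[ℂ] _)).1 m = _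
      rw [ofTensor_coeff, smul_coeff, smul_assoc]
      rfl

end Lau

open Lau

/-- The vertex operator map with values in Laurent series. -/
def NLVA.YL {V : Type*} [AddCommGroup V] [Module ℂ V] (𝒱 : NLVA V) : V →ₗ[ℂ] V →ₗ[ℂ] Lau V :=
  bundle 𝒱.Y 𝒱.trunc

theorem NLVA.wa {V : Type*} [AddCommGroup V] [Module ℂ V] (𝒱 : NLVA V) (u v w : V) :
    WA (map (𝒱.YL u) (𝒱.YL v w)) (map (𝒱.YL.flip w) (𝒱.YL u v)) :=
  (wa_iff _ _).2 (𝒱.weak_assoc u v w)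

/-- The module vertex operator map with values in Laurent series. -/
def NLVAModule.YL {V W : Type*} [AddCommGroup V] [Module ℂ V] [AddCommGroup W] [Module ℂ W]
    {𝒱 : NLVA V} (𝒲 : NLVAModule 𝒱 W) : V →ₗ[ℂ] W →ₗ[ℂ] Lau W :=
  bundle 𝒲.Yw 𝒲.trunc

theorem NLVAModule.wa {V W : Type*} [AddCommGroup V] [Module ℂ V] [AddCommGroup W] [Module ℂ W]
    {𝒱 : NLVA V} (𝒲 : NLVAModule 𝒱 W) (u v : V) (w : W) :
    WA (map (𝒲.YL u) (𝒲.YL v w)) (map (𝒲.YL.flip w) (𝒱.YL u v)) :=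
  (wa_iff _ _).2 (𝒲.weak_assoc u v w)

namespace NLVModAlg

variable {H U : Type*} [AddCommGroup H] [Module ℂ H] [AddCommGroup U] [Module ℂ U]
  {𝓗 : NLVBialg H} (MU : NLVModAlg 𝓗 U)

/-- The action with values in `U ⊗ ℂ((x))`. -/
def actT : H →ₗ[ℂ] U →ₗ[ℂ] U ⊗[ℂ] Lau ℂ := factor MU.act.YL MU.scalar

theorem ofTensor_actT (h : H) (u : U) : ofTensor (MU.actT h u) = MU.act.YL h u :=
  ofTensor_factor _ _ h u

/-- The map `(c ⊗ d) ⊗ w ↦ Y(Y(c, x₁ - x₂)u, x₂) Y(d, x₁)w` (outer variable `x₂`). -/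
def actAct (u : U) : H ⊗[ℂ] H →ₗ[ℂ] U →ₗ[ℂ] Lau (U ⊗[ℂ] Lau ℂ) :=
  TensorProduct.lift ((LinearMap.llcomp ℂ U (U ⊗[ℂ] Lau ℂ) (Lau (U ⊗[ℂ] Lau ℂ)) ∘ₗ
    shiftMul MU.alg.YL ∘ₗ MU.actT.flip u).compl₂ MU.actT)

theorem actAct_tmul (u : U) (c d : H) (w : U) :
    MU.actAct u (c ⊗ₜ[ℂ] d) w = shiftMul MU.alg.YL (MU.actT c u) (MU.actT d w) := rfl

/-- The linear extension of `shiftTerm` to tensors. -/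
def compatTerm (u w : U) (n m : ℤ) (i : ℕ) : H ⊗[ℂ] H →ₗ[ℂ] U :=
  TensorProduct.lift ((shiftTerm (MU.alg.Yc (n - i)) m i).compl₁₂
    (MU.act.YL.flip u) (MU.act.YL.flip w))

theorem actAct_coeff (u w : U) (ω : H ⊗[ℂ] H) (n m : ℤ) :
    ∃ N₀, ∀ N ≥ N₀, ((map ofTensor (MU.actAct u ω w)).1 n).1 m = ∑ i ∈ Finset.range N,
      MU.compatTerm u w n m i ω := by
  induction ω with
  | zero => exact ⟨0, fun N _ => by simp⟩
  | add s s' hs hs' =>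
    obtain ⟨N₁, h₁⟩ := hs
    obtain ⟨N₂, h₂⟩ := hs'
    refine ⟨max N₁ N₂, fun N hN => ?_⟩
    simp only [map_add, LinearMap.add_apply, add_coeff, Finset.sum_add_distrib]
    rw [h₁ N (le_trans (le_max_left _ _) hN), h₂ N (le_trans (le_max_right _ _) hN)]
  | tmul c d =>
    obtain ⟨N₀, h⟩ := shiftMul_coeff MU.alg.YL (MU.actT c u) (MU.actT d w) n m
    refine ⟨N₀, fun N hN => ?_⟩
    rw [actAct_tmul, h N hN, ofTensor_actT, ofTensor_actT]
    rfl

theorem compatTerm_eq_finsum (u w : U) (ω : H ⊗[ℂ] H) (n m : ℤ) (i : ℕ) :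
    (Function.support fun p : ℤ => ((-1 : ℂ) ^ i * ((zchoose p i : ℤ) : ℂ)) •
      (TensorProduct.lift
        (((MU.alg.Yc (n - i)).comp ((MU.act.Yw.compr₂ (LinearMap.proj p)).flip u)).compl₂
          ((MU.act.Yw.compr₂ (LinearMap.proj (m - p + i))).flip w))) ω).Finite ∧
    ∑ᶠ p : ℤ, ((-1 : ℂ) ^ i * ((zchoose p i : ℤ) : ℂ)) •
      (TensorProduct.lift
        (((MU.alg.Yc (n - i)).comp ((MU.act.Yw.compr₂ (LinearMap.proj p)).flip u)).compl₂
          ((MU.act.Yw.compr₂ (LinearMap.proj (m - p + i))).flip w))) ω =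
      MU.compatTerm u w n m i ω := by
  induction ω with
  | zero => simp
  | add s s' hs hs' =>
    simp only [map_add, smul_add]
    refine ⟨(hs.1.union hs'.1).subset (Function.support_add _ _), ?_⟩
    rw [finsum_add_distrib hs.1 hs'.1, hs.2, hs'.2]
  | tmul c d =>
    obtain ⟨K, hK⟩ := exists_ge (MU.act.YL c u)
    obtain ⟨L, hL⟩ := exists_ge (MU.act.YL d w)
    have e : ∀ p : ℤ, ((-1 : ℂ) ^ i * ((zchoose p i : ℤ) : ℂ)) •
        (TensorProduct.lift
          (((MU.alg.Yc (n - i)).comp ((MU.act.Yw.compr₂ (LinearMap.proj p)).flip u)).compl₂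
            ((MU.act.Yw.compr₂ (LinearMap.proj (m - p + i))).flip w))) (c ⊗ₜ[ℂ] d) =
        (-1 : ℂ) ^ i • MU.alg.Yc (n - i) ((hasse i (MU.act.YL c u)).1 (p - i))
          ((MU.act.YL d w).1 (m - (p - i))) := by
      intro p
      rw [hasse_coeff, sub_add_cancel, map_smul, LinearMap.smul_apply, smul_smul,
        zchoose_eq_choose, sub_sub_eq_add_sub, add_sub_right_comm]
      rfl
    simp only [e]
    constructor
    · refine ((Finset.finite_toSet (Finset.Icc K (m + i - L)))).subset fun p hp => ?_
      by_contra h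
      refine hp ?_
      simp only [Finset.coe_Icc, Set.mem_Icc, not_and_or, not_le] at h
      dsimp only
      rcases h with h | h
      · rw [hasse_coeff, sub_add_cancel, hK p h]; simp
      · rw [hL (m - (p - i)) (by omega)]; simp
    · rw [← smul_finsum]
      exact congrArg ((-1 : ℂ) ^ i • ·) (finsum_comp_equiv (Equiv.subRight (i : ℤ))
        (f := fun q => MU.alg.Yc (n - i) ((hasse i (MU.act.YL c u)).1 q)
          ((MU.act.YL d w).1 (m - q))))

theorem map_actT (b : H) (u w : U) :
    map (MU.actT b) (MU.alg.YL u w) = MU.actAct u (𝓗.comul b) w := by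
  refine map_injective ofTensor_injective (ext fun n => ext fun m => ?_)
  obtain ⟨N₀, h⟩ := MU.actAct_coeff u w (𝓗.comul b) n m
  have h0 : ∀ i ≥ N₀, MU.compatTerm u w n m i (𝓗.comul b) = 0 := by
    intro i hi
    have h1 := h (i + 1) (by omega)
    rw [Finset.sum_range_succ, ← h i hi] at h1
    simpa using h1
  rw [h N₀ le_rfl, map_coeff, map_coeff, ofTensor_actT]
  refine (MU.compat b u w m n).trans ?_
  rw [finsum_congr fun i => (MU.compatTerm_eq_finsum u w (𝓗.comul b) n m i).2]
  refine finsum_eq_sum_of_support_subset _ fun i hi => ?_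
  by_contra h2
  exact hi (h0 i (by simpa using h2))

/-- `Y(d, x₂ + x₀) Y(b, x₂) w` as a series in `x₀`. -/
def actShift (d : H) : U ⊗[ℂ] Lau ℂ →ₗ[ℂ] Lau (U ⊗[ℂ] Lau ℂ) :=
  TensorProduct.lift (taylorMul ∘ₗ MU.actT d)

theorem map_actT_flip (d b : H) (w : U) :
    map (MU.actT.flip w) (𝓗.alg.YL d b) = MU.actShift d (MU.actT b w) := by
  refine map_injective ofTensor_injective ?_
  have h : ∀ t, WA (map (MU.act.YL d) (ofTensor t)) (map ofTensor (MU.actShift d t)) := by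
    intro t
    induction t with
    | zero => simpa using WA.zero
    | add s t hs ht =>
      simp only [map_add]
      exact hs.add ht
    | tmul w h =>
      have := WA.taylorMul (MU.actT d w) h
      rw [ofTensor_actT] at this
      rw [ofTensor_tmul, map_conv_sm, map_single]
      exact this
  have h1 := h (MU.actT b w)
  rw [ofTensor_actT] at h1
  have h2 : map ofTensor (map (MU.actT.flip w) (𝓗.alg.YL d b)) =
      map (MU.act.YL.flip w) (𝓗.alg.YL d b) :=
    ext fun n => MU.ofTensor_actT _ w
  rw [h2]
  exact (MU.act.wa d b w).unique h1

/-- The series `Y(u, x) Y(h, x) u'`. -/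
def YY : U →ₗ[ℂ] H →ₗ[ℂ] U →ₗ[ℂ] Lau U :=
  (LinearMap.llcomp ℂ U (U ⊗[ℂ] Lau ℂ) (Lau U) ∘ₗ extend MU.alg.YL).compl₂ MU.actT

theorem YY_apply (u : U) (h : H) (u' : U) :
    MU.YY u h u' = extend MU.alg.YL u (MU.actT h u') := rfl

/-- The series `Y(u, x₁) Y(c, x₁) Y(u', x₂) Y(d, x₂)` rewritten by compatibility. -/
def YYact (u u' : U) : H ⊗[ℂ] H →ₗ[ℂ] U →ₗ[ℂ] Lau (Lau U) :=
  (MU.actAct u').compr₂ (map (extend MU.alg.YL u))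

theorem map_YY (u u' : U) (b : H) (t : U ⊗[ℂ] Lau ℂ) :
    map (MU.YY u b) (extend MU.alg.YL u' t) = extend (MU.YYact u u') (𝓗.comul b) t := by
  induction t with
  | zero => simp
  | add s t hs ht => simp only [map_add, hs, ht]
  | tmul w h =>
    rw [extend_tmul, extend_tmul, map_conv_sm, YYact, LinearMap.compr₂_apply, ← map_actT]
    rfl

theorem wa_YYact (u u' : U) (c d : H) (t : U ⊗[ℂ] Lau ℂ) :
    WA (extend (MU.YYact u u') (c ⊗ₜ[ℂ] d) t)
      (conv (extend MU.alg.YL) (MU.YY u c u') (MU.actShift d t)) := by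
  induction t with
  | zero => simpa using WA.zero
  | add s t hs ht =>
    simp only [map_add]
    exact hs.add ht
  | tmul w h => exact WA.shiftMul MU.alg.YL MU.alg.wa u (MU.actT c u') (MU.actT d w) h

end NLVModAlg

section Smash

variable {H U V : Type*} [AddCommGroup H] [Module ℂ H] [AddCommGroup U] [Module ℂ U]
  [AddCommGroup V] [Module ℂ V] {𝓗 : NLVBialg H} (MU : NLVModAlg 𝓗 U) (CV : NLVComodAlg 𝓗 V)

/-- The map `u ⊗ (h ⊗ y) ⊗ (u' ⊗ v') ↦ Y(u, x) Y(h, x) u' ⊗ Y(y, x) v'`. -/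
def smashPre : U →ₗ[ℂ] H ⊗[ℂ] V →ₗ[ℂ] U ⊗[ℂ] V →ₗ[ℂ] Lau (U ⊗[ℂ] V) :=
  TensorProduct.curry (((TensorProduct.map₂ (TensorProduct.lift MU.YY) CV.alg.YL).compr₂
    (TensorProduct.lift (conv (TensorProduct.mk ℂ U V)))) ∘ₗ
      (TensorProduct.assoc ℂ U H V).symm.toLinearMap)

theorem smashPre_tmul (u : U) (h : H) (y : V) (u' : U) (v' : V) :
    smashPre MU CV u (h ⊗ₜ[ℂ] y) (u' ⊗ₜ[ℂ] v') =
      conv (TensorProduct.mk ℂ U V) (MU.YY u h u') (CV.alg.YL y v') := rfl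

/-- The vertex operator map of the smash product. -/
def smashY : U ⊗[ℂ] V →ₗ[ℂ] U ⊗[ℂ] V →ₗ[ℂ] Lau (U ⊗[ℂ] V) :=
  TensorProduct.lift ((smashPre MU CV).compl₂ CV.rho)

theorem smashY_tmul (u : U) (v : V) :
    smashY MU CV (u ⊗ₜ[ℂ] v) = smashPre MU CV u (CV.rho v) := rfl

/-- The vertex operator map of `H ⊗ V`. -/
def NLVComodAlg.YHV : H ⊗[ℂ] V →ₗ[ℂ] H ⊗[ℂ] V →ₗ[ℂ] Lau (H ⊗[ℂ] V) :=
  (TensorProduct.map₂ 𝓗.alg.YL CV.alg.YL).compr₂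
    (TensorProduct.lift (conv (TensorProduct.mk ℂ H V)))

theorem NLVComodAlg.YHV_coeff (s t : H ⊗[ℂ] V) (n : ℤ) :
    (Function.support fun p : ℤ =>
      TensorProduct.map₂ (𝓗.alg.Yc p) (CV.alg.Yc (n - p)) s t).Finite ∧
    ∑ᶠ p : ℤ, TensorProduct.map₂ (𝓗.alg.Yc p) (CV.alg.Yc (n - p)) s t = (CV.YHV s t).1 n := by
  induction s with
  | zero => simp
  | add s s' hs hs' =>
    simp only [map_add, LinearMap.add_apply]
    refine ⟨(hs.1.union hs'.1).subset (Function.support_add _ _), ?_⟩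
    rw [finsum_add_distrib hs.1 hs'.1, hs.2, hs'.2, add_coeff]
  | tmul h y =>
    induction t with
    | zero => simp
    | add s s' hs hs' =>
      simp only [map_add]
      refine ⟨(hs.1.union hs'.1).subset (Function.support_add _ _), ?_⟩
      rw [finsum_add_distrib hs.1 hs'.1, hs.2, hs'.2, add_coeff]
    | tmul h' y' =>
      obtain ⟨K, hK⟩ := exists_ge (𝓗.alg.YL h h')
      obtain ⟨L, hL⟩ := exists_ge (CV.alg.YL y y')
      exact ⟨(Finset.finite_toSet _).subset
        (conv_support (TensorProduct.mk ℂ H V) hK hL n), rfl⟩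

theorem NLVComodAlg.map_rho (v v' : V) :
    map CV.rho (CV.alg.YL v v') = CV.YHV (CV.rho v) (CV.rho v') :=
  ext fun n => (CV.rho_mul v v' n).trans (CV.YHV_coeff _ _ n).2

/-- The iterate `Y(Y(u, x₀) Y(b, x₀) u' ⊗ Y(ω, x₀) τ, x₂) w` as a function of `b ⊗ ω`. -/
def smashIter (u u' : U) (w : U ⊗[ℂ] V) (τ : H ⊗[ℂ] V) :
    H ⊗[ℂ] (H ⊗[ℂ] V) →ₗ[ℂ] Lau (Lau (U ⊗[ℂ] V)) :=
  TensorProduct.lift ((conv ((smashPre MU CV).compr₂ (LinearMap.applyₗ w))).compl₁₂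
    ((MU.YY u).flip u') (CV.YHV.flip τ))

theorem map_smashY_flip (u u' : U) (v' : V) (w : U ⊗[ℂ] V) (ω : H ⊗[ℂ] V) :
    map ((smashY MU CV).flip w) (smashPre MU CV u ω (u' ⊗ₜ[ℂ] v')) =
      smashIter MU CV u u' w (CV.rho v') (LinearMap.lTensor H CV.rho ω) := by
  induction ω with
  | zero => simp
  | add s t hs ht => simp only [map_add, LinearMap.add_apply, hs, ht]
  | tmul h y =>
    rw [smashPre_tmul, map_conv, LinearMap.lTensor_tmul]
    change _ = conv _ (MU.YY u h u') (CV.YHV (CV.rho y) (CV.rho v'))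
    rw [← CV.map_rho]
    rfl

/-- The product `Y(u, x₁) Y(c, x₁) Y(u', x₂) t ⊗ Y(y, x₁) Y(y', x₂) v''` in which the first
factor has been rewritten by compatibility, as a function of `(c ⊗ d) ⊗ y`. -/
def smashProd (u u' : U) (t : U ⊗[ℂ] Lau ℂ) (a : Lau V) :
    (H ⊗[ℂ] H) ⊗[ℂ] V →ₗ[ℂ] Lau (Lau (U ⊗[ℂ] V)) :=
  TensorProduct.lift ((conv (conv (TensorProduct.mk ℂ U V))).compl₁₂
    ((extend (MU.YYact u u')).flip t) (mapHom.flip a ∘ₗ CV.alg.YL))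

theorem map_smashPre (u u' : U) (h' : H) (y' : V) (u'' : U) (v'' : V) (ω : H ⊗[ℂ] V) :
    map (smashPre MU CV u ω) (smashPre MU CV u' (h' ⊗ₜ[ℂ] y') (u'' ⊗ₜ[ℂ] v'')) =
      smashProd MU CV u u' (MU.actT h' u'') (CV.alg.YL y' v'')
        (LinearMap.rTensor V 𝓗.comul ω) := by
  rw [smashPre_tmul]
  induction ω with
  | zero => simp [← mapHom_apply]
  | add s t hs ht =>
    rw [map_add, ← mapHom_apply, map_add, LinearMap.add_apply, mapHom_apply, mapHom_apply, hs, ht,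
      map_add, map_add]
  | tmul h y =>
    rw [LinearMap.rTensor_tmul]
    change _ = conv (conv (TensorProduct.mk ℂ U V))
      (extend (MU.YYact u u') (𝓗.comul h) (MU.actT h' u'')) (map (CV.alg.YL y) (CV.alg.YL y' v''))
    rw [← MU.map_YY, ← MU.YY_apply]
    exact map_conv_of _ _ _ _ _ (fun m n => rfl) _ _

theorem wa_smashProd (u u' : U) (h' : H) (y' : V) (u'' : U) (v'' : V)
    (ω : H ⊗[ℂ] (H ⊗[ℂ] V)) :
    WA (smashProd MU CV u u' (MU.actT h' u'') (CV.alg.YL y' v'')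
        ((TensorProduct.assoc ℂ H H V).symm ω))
      (smashIter MU CV u u' (u'' ⊗ₜ[ℂ] v'') (h' ⊗ₜ[ℂ] y') ω) := by
  induction ω with
  | zero => simpa using WA.zero
  | add s t hs ht =>
    simp only [map_add]
    exact hs.add ht
  | tmul h x =>
    induction x with
    | zero => simpa using WA.zero
    | add s t hs ht =>
      simp only [map_add, TensorProduct.tmul_add]
      exact hs.add ht
    | tmul d y =>
      have e : conv ((smashPre MU CV).compr₂ (LinearMap.applyₗ (u'' ⊗ₜ[ℂ] v''))) (MU.YY u h u')
          (conv (TensorProduct.mk ℂ H V) (𝓗.alg.YL d h') (CV.alg.YL y y')) =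
          conv (conv (TensorProduct.mk ℂ U V))
            (conv (extend MU.alg.YL) (MU.YY u h u') (MU.actShift d (MU.actT h' u'')))
            (map (CV.alg.YL.flip v'') (CV.alg.YL y y')) := by
        rw [← MU.map_actT_flip]
        exact (conv_assoc ((conv (TensorProduct.mk ℂ U V)).compl₂ (CV.alg.YL.flip v''))
          ((extend MU.alg.YL).compl₂ (MU.actT.flip u'')) _ _ (fun _ _ _ => rfl) _ _ _).symm
      have := (MU.wa_YYact u u' h d (MU.actT h' u'')).conv (TensorProduct.mk ℂ U V)
        (CV.alg.wa y y' v'')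
      rw [← e] at this
      exact this

theorem wa_smashY (t₁ t₂ t₃ : U ⊗[ℂ] V) :
    WA (map (smashY MU CV t₁) (smashY MU CV t₂ t₃))
      (map ((smashY MU CV).flip t₃) (smashY MU CV t₁ t₂)) := by
  simp only [← mapHom_apply]
  induction t₁ with
  | zero => simpa using WA.zero
  | add s t hs ht =>
    simp only [map_add, LinearMap.add_apply]
    exact hs.add ht
  | tmul u v =>
    induction t₂ with
    | zero => simpa using WA.zero
    | add s t hs ht =>
      simp only [map_add, LinearMap.add_apply]
      exact hs.add ht
    | tmul u' v' =>
      induction t₃ with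
      | zero => simpa using WA.zero
      | add s t hs ht =>
        simp only [map_add, LinearMap.add_apply]
        exact hs.add ht
      | tmul u'' v'' =>
        rw [mapHom_apply, mapHom_apply, smashY_tmul, smashY_tmul, map_smashY_flip]
        generalize CV.rho v' = τ
        induction τ with
        | zero =>
          have e : smashIter MU CV u u' (u'' ⊗ₜ[ℂ] v'') 0 = 0 :=
            TensorProduct.ext' fun h x => by simp [smashIter]
          rw [e, map_zero]
          simpa using WA.zero (M := U ⊗[ℂ] V)
        | add s t hs ht =>
          have e : smashIter MU CV u u' (u'' ⊗ₜ[ℂ] v'') (s + t) =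
              smashIter MU CV u u' (u'' ⊗ₜ[ℂ] v'') s + smashIter MU CV u u' (u'' ⊗ₜ[ℂ] v'') t :=
            TensorProduct.ext' fun h x => by simp [smashIter]
          rw [e]
          simp only [map_add, LinearMap.add_apply]
          exact hs.add ht
        | tmul h' y' =>
          rw [map_smashPre]
          have := wa_smashProd MU CV u u' h' y' u'' v'' (LinearMap.lTensor H CV.rho (CV.rho v))
          rwa [CV.coassoc, LinearEquiv.symm_apply_apply, ← CV.coassoc] at this

theorem finsum_conv_ofTensor (u : U) (t : U ⊗[ℂ] Lau ℂ) (z : Lau V) (n : ℤ) :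
    (Function.support fun a : ℤ => (conv (TensorProduct.mk ℂ U V ∘ₗ MU.alg.Yc a u)
      (ofTensor t) z).1 (n - a)).Finite ∧
    ∑ᶠ a : ℤ, (conv (TensorProduct.mk ℂ U V ∘ₗ MU.alg.Yc a u) (ofTensor t) z).1 (n - a) =
      (conv (TensorProduct.mk ℂ U V) (extend MU.alg.YL u t) z).1 n := by
  induction t with
  | zero => simp
  | add s t hs ht =>
    simp only [map_add, LinearMap.add_apply, add_coeff]
    refine ⟨(hs.1.union ht.1).subset (Function.support_add _ _), ?_⟩
    rw [finsum_add_distrib hs.1 ht.1, hs.2, ht.2]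
  | tmul w g =>
    have e : ∀ a : ℤ, (conv (TensorProduct.mk ℂ U V ∘ₗ MU.alg.Yc a u)
        (ofTensor (w ⊗ₜ[ℂ] g)) z).1 (n - a) =
        TensorProduct.mk ℂ U V ((MU.alg.YL u w).1 a) ((conv (sm V) g z).1 (n - a)) := by
      intro a
      rw [ofTensor_tmul, conv_sm_left, conv_single_zero, ← map_conv_sm]
      rfl
    simp only [e]
    obtain ⟨K, hK⟩ := exists_ge (MU.alg.YL u w)
    obtain ⟨L, hL⟩ := exists_ge (conv (sm V) g z)
    refine ⟨(Finset.finite_toSet _).subset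
      (conv_support (TensorProduct.mk ℂ U V) hK hL n), ?_⟩
    rw [extend_tmul, conv_sm_left, ← conv_sm_right]
    rfl

theorem smashPre_coeff (u u' : U) (v' : V) (ω : H ⊗[ℂ] V) (n : ℤ) :
    ∃ X : ℤ → U ⊗[ℂ] V, (∀ a, (Function.support fun p : ℤ => TensorProduct.map
        ((MU.alg.Yc a u).comp ((MU.act.Yw.compr₂ (LinearMap.proj p)).flip u'))
        ((CV.alg.Yc (n - a - p)).flip v') ω).Finite ∧
      ∑ᶠ p : ℤ, TensorProduct.map
        ((MU.alg.Yc a u).comp ((MU.act.Yw.compr₂ (LinearMap.proj p)).flip u'))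
        ((CV.alg.Yc (n - a - p)).flip v') ω = X a) ∧
      (Function.support X).Finite ∧
      ∑ᶠ a, X a = (smashPre MU CV u ω (u' ⊗ₜ[ℂ] v')).1 n := by
  induction ω with
  | zero => exact ⟨0, fun a => by simp, by simp, by simp⟩
  | add s t hs ht =>
    obtain ⟨X, hX, fX, eX⟩ := hs
    obtain ⟨Z, hZ, fZ, eZ⟩ := ht
    refine ⟨X + Z, fun a => ?_, (fX.union fZ).subset (Function.support_add _ _), ?_⟩
    · simp only [map_add]
      refine ⟨((hX a).1.union (hZ a).1).subset (Function.support_add _ _), ?_⟩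
      rw [finsum_add_distrib (hX a).1 (hZ a).1, (hX a).2, (hZ a).2, Pi.add_apply]
    · simp only [Pi.add_apply, map_add, LinearMap.add_apply, add_coeff]
      rw [finsum_add_distrib fX fZ, eX, eZ]
  | tmul h y =>
    have key := finsum_conv_ofTensor MU u (MU.actT h u') (CV.alg.YL y v') n
    rw [MU.ofTensor_actT] at key
    obtain ⟨K, hK⟩ := exists_ge (MU.act.YL h u')
    obtain ⟨L, hL⟩ := exists_ge (CV.alg.YL y v')
    exact ⟨_, fun a => ⟨(Finset.finite_toSet _).subset
      (conv_support (TensorProduct.mk ℂ U V ∘ₗ MU.alg.Yc a u) hK hL (n - a)), rfl⟩, key⟩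

theorem smashY_eq_Ysharp (u u' : U) (v v' : V) (n : ℤ) :
    (smashY MU CV (u ⊗ₜ[ℂ] v) (u' ⊗ₜ[ℂ] v')).1 n = Ysharp 𝓗 MU CV u v u' v' n := by
  obtain ⟨X, hX, -, eX⟩ := smashPre_coeff MU CV u u' v' (CV.rho v) n
  rw [smashY_tmul, ← eX]
  exact (finsum_congr fun a => (hX a).2).symm

theorem NLVA.YL_one (𝒱 : NLVA V) (v : V) : 𝒱.YL 𝒱.one v = single 0 v :=
  ext fun n => (𝒱.vacuum_left v n).trans (single_coeff 0 v n).symm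

theorem NLVA.YL_one_right (𝒱 : NLVA V) (v : V) :
    Ge 0 (𝒱.YL v 𝒱.one) ∧ (𝒱.YL v 𝒱.one).1 0 = v :=
  ⟨𝒱.creation_reg v, 𝒱.creation_zero v⟩

theorem ofTensor_tmul_single (u : U) : ofTensor (u ⊗ₜ[ℂ] single 0 (1 : ℂ)) = single 0 u := by
  rw [ofTensor_tmul, conv_single_single, add_zero]
  exact congrArg (single 0) (one_smul ℂ u)

theorem extend_tmul_single (F : U →ₗ[ℂ] U →ₗ[ℂ] Lau U) (u w : U) :
    extend F u (w ⊗ₜ[ℂ] single 0 (1 : ℂ)) = F u w := by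
  rw [extend_tmul, conv_single_zero]
  exact ext fun n => one_smul ℂ _

theorem NLVModAlg.actT_one (u : U) : MU.actT 𝓗.alg.one u = u ⊗ₜ[ℂ] single 0 (1 : ℂ) :=
  ofTensor_injective (by
    rw [MU.ofTensor_actT, ofTensor_tmul_single]
    exact ext fun n => (MU.act.vacuum u n).trans (single_coeff 0 u n).symm)

theorem NLVModAlg.actT_vac (h : H) :
    MU.actT h MU.alg.one = 𝓗.counit h • (MU.alg.one ⊗ₜ[ℂ] single 0 (1 : ℂ)) :=
  ofTensor_injective (by
    rw [MU.ofTensor_actT, map_smul, ofTensor_tmul_single, ← map_smul]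
    exact ext fun n => (MU.vac h n).trans (single_coeff 0 _ n).symm)

theorem smashY_one (t : U ⊗[ℂ] V) :
    smashY MU CV (MU.alg.one ⊗ₜ[ℂ] CV.alg.one) t = single 0 t := by
  induction t with
  | zero => simp
  | add s t hs ht => simp only [map_add, hs, ht]
  | tmul u v =>
    rw [smashY_tmul, CV.rho_one, smashPre_tmul, MU.YY_apply, MU.actT_one, extend_tmul_single,
      MU.alg.YL_one, CV.alg.YL_one, conv_single_single, add_zero]
    rfl

theorem smashPre_one (u : U) (ω : H ⊗[ℂ] V) :
    smashPre MU CV u ω (MU.alg.one ⊗ₜ[ℂ] CV.alg.one) =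
      conv (TensorProduct.mk ℂ U V) (MU.alg.YL u MU.alg.one)
        (CV.alg.YL (TensorProduct.lid ℂ V (LinearMap.rTensor V 𝓗.counit ω)) CV.alg.one) := by
  induction ω with
  | zero => simp
  | add s t hs ht => simp only [map_add, LinearMap.add_apply, hs, ht]
  | tmul h y =>
    rw [smashPre_tmul, MU.YY_apply, MU.actT_vac, map_smul, extend_tmul_single,
      LinearMap.rTensor_tmul, TensorProduct.lid_tmul]
    simp only [map_smul, LinearMap.smul_apply]

theorem smashY_vac (t : U ⊗[ℂ] V) :
    Ge 0 (smashY MU CV t (MU.alg.one ⊗ₜ[ℂ] CV.alg.one)) ∧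
      (smashY MU CV t (MU.alg.one ⊗ₜ[ℂ] CV.alg.one)).1 0 = t := by
  induction t with
  | zero => simp [Ge]
  | add s t hs ht =>
    simp only [map_add, LinearMap.add_apply]
    refine ⟨fun n hn => ?_, ?_⟩
    · rw [add_coeff, hs.1 n hn, ht.1 n hn, add_zero]
    · rw [add_coeff, hs.2, ht.2]
  | tmul u v =>
    obtain ⟨gu, eu⟩ := MU.alg.YL_one_right u
    obtain ⟨gv, ev⟩ := CV.alg.YL_one_right v
    rw [smashY_tmul, smashPre_one, CV.counit_rho]
    refine ⟨by simpa using gu.conv (TensorProduct.mk ℂ U V) gv, ?_⟩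
    rw [conv_coeff_sum _ gu gv]
    simp [eu, ev]

/-- The smash product nonlocal vertex algebra. -/
def smashProduct : NLVA (U ⊗[ℂ] V) where
  Y := (smashY MU CV).compr₂ (Submodule.subtype _)
  one := MU.alg.one ⊗ₜ[ℂ] CV.alg.one
  trunc u v := (smashY MU CV u v).2
  vacuum_left t n :=
    (congrArg (fun a : Lau (U ⊗[ℂ] V) => a.1 n) (smashY_one MU CV t)).trans (single_coeff 0 t n)
  creation_reg t := (smashY_vac MU CV t).1
  creation_zero t := (smashY_vac MU CV t).2
  weak_assoc t₁ t₂ t₃ := (wa_iff _ _).1 (wa_smashY MU CV t₁ t₂ t₃)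

end Smash

/-- The smash product `U ♯ V` of a nonlocal vertex `H`-module-algebra
`U` and a nonlocal vertex `H`-comodule-algebra `V` is a nonlocal vertex algebra
(Proposition 4.4). -/
theorem statement_17 {H U V : Type*} [AddCommGroup H] [Module ℂ H]
    [AddCommGroup U] [Module ℂ U] [AddCommGroup V] [Module ℂ V]
    (𝓗 : NLVBialg H) (MU : NLVModAlg 𝓗 U) (CV : NLVComodAlg 𝓗 V) :
    ∃ 𝒮 : NLVA (U ⊗[ℂ] V), 𝒮.one = MU.alg.one ⊗ₜ CV.alg.one ∧
      ∀ (u u' : U) (v v' : V) (n : ℤ),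
        𝒮.Y (u ⊗ₜ v) (u' ⊗ₜ v') n = Ysharp 𝓗 MU CV u v u' v' n := by
  exact ⟨smashProduct MU CV, rfl, smashY_eq_Ysharp MU CV⟩
end
end

section
/- Let H be a nonlocal vertex bialgebra, U a nonlocal vertex (left) H-module-algebra, and V a nonlocal vertex (left) H-comodule-algebra with coaction ρ(v) = b¹(v)⊗v². Define the linear map R(x): V⊗U → U⊗V⊗ℂ((x)) by R(x)(v⊗u) = Y(b¹(v),−x)u ⊗ v². Then R(x) is a twisting operator for the ordered pair (U,V), and the smash product U♯V equals the twisted tensor product U⊗_R V (same vacuum and identical vertex operator maps Y_♯ = Y_R). -/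
open scoped TensorProduct BigOperators

noncomputable section

section StrictAssociativity

theorem zchoose_zero_right (n : ℤ) : zchoose n 0 = 1 := by
  simp [zchoose_eq_choose]

theorem zchoose_succ (n : ℤ) (k : ℕ) :
    zchoose n (k + 1) = zchoose (n - 1) k + zchoose (n - 1) (k + 1) := by
  have := Ring.choose_succ_succ (n - 1) k
  rw [sub_add_cancel] at this
  simpa only [zchoose_eq_choose] using this

theorem zchoose_natCast (n k : ℕ) : zchoose n k = n.choose k := by
  simp [zchoose]

theorem finsum_nat_eq_add_succ {M : Type*} [AddCommMonoid M] (f : ℕ → M)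
    (hf : f.support.Finite) : ∑ᶠ i, f i = f 0 + ∑ᶠ i, f (i + 1) := by
  obtain ⟨N, hN⟩ := hf.bddAbove
  rw [finsum_eq_sum_of_support_subset f (s := Finset.range (N + 2)),
    finsum_eq_sum_of_support_subset (fun i => f (i + 1)) (s := Finset.range (N + 1)),
    Finset.sum_range_succ', add_comm]
  · intro i hi
    have := hN (a := i + 1) hi
    simp; omega
  · intro i hi
    have := hN hi
    simp; omega

variable {V : Type*} [AddCommGroup V] [Module ℂ V]

/-- Multiplication of a double series by its first variable. -/
def shiftFst : Module.End ℂ (ℤ → ℤ → V) where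
  toFun A m n := A (m - 1) n
  map_add' _ _ := rfl
  map_smul' _ _ := rfl

/-- Multiplication of a double series by its second variable. -/
def shiftSnd : Module.End ℂ (ℤ → ℤ → V) where
  toFun A m n := A m (n - 1)
  map_add' _ _ := rfl
  map_smul' _ _ := rfl

theorem shiftFst_pow_apply (k : ℕ) (A : ℤ → ℤ → V) (m n : ℤ) :
    (shiftFst ^ k) A m n = A (m - k) n := by
  induction k generalizing m with
  | zero => simp
  | succ k ih =>
    rw [pow_succ']
    change (shiftFst ^ k) A (m - 1) n = _
    rw [ih]
    congr 1
    push_cast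
    ring

theorem shiftSnd_pow_apply (k : ℕ) (A : ℤ → ℤ → V) (m n : ℤ) :
    (shiftSnd ^ k) A m n = A m (n - k) := by
  induction k generalizing n with
  | zero => simp
  | succ k ih =>
    rw [pow_succ']
    change (shiftSnd ^ k) A m (n - 1) = _
    rw [ih]
    congr 1
    push_cast
    ring

theorem shiftFst_add_shiftSnd_apply (A : ℤ → ℤ → V) (m n : ℤ) :
    (shiftFst + shiftSnd : Module.End ℂ (ℤ → ℤ → V)) A m n = A (m - 1) n + A m (n - 1) := rfl

theorem mulAddPow_eq_pow (k : ℕ) (A : ℤ → ℤ → V) :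
    mulAddPow k A = ((shiftFst + shiftSnd : Module.End ℂ (ℤ → ℤ → V)) ^ k) A := by
  have hc : Commute (shiftSnd : Module.End ℂ (ℤ → ℤ → V)) shiftFst := rfl
  funext a b
  rw [add_comm, hc.add_pow]
  simp only [mulAddPow, LinearMap.sum_apply, Finset.sum_apply]
  refine Finset.sum_congr rfl fun j hj => ?_
  have hj' : j ≤ k := by simpa [Nat.lt_succ_iff] using hj
  rw [(Nat.cast_commute (k.choose j) _).symm.eq, Module.End.mul_apply, Module.End.natCast_apply,
    Module.End.mul_apply]
  change _ = (k.choose j) • (shiftSnd ^ j) ((shiftFst ^ (k - j)) A) a b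
  rw [shiftSnd_pow_apply, shiftFst_pow_apply, Nat.cast_smul_eq_nsmul]
  congr 2
  push_cast [hj']
  ring

theorem substAdd02_shiftFst (A : ℤ → ℤ → V) (N : ℤ) (hA : ∀ m n, n < N → A m n = 0) :
    substAdd02 (shiftFst A) = (shiftFst + shiftSnd : Module.End ℂ (ℤ → ℤ → V)) (substAdd02 A) := by
  have fin : ∀ (g : ℕ → ℂ) (f : ℕ → ℤ) (b : ℤ),
      (Function.support fun i : ℕ => g i • A (f i) (b - i)).Finite := by
    intro g f b
    refine (Set.finite_Iic (b - N).toNat).subset fun i hi => ?_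
    by_contra h
    refine hi ?_
    simp only [Set.mem_Iic] at h
    beta_reduce
    rw [hA _ _ (by omega), smul_zero]
  funext a b
  rw [shiftFst_add_shiftSnd_apply]
  simp only [substAdd02, shiftFst, LinearMap.coe_mk, AddHom.coe_mk]
  rw [finsum_nat_eq_add_succ _ (fin _ _ _), finsum_nat_eq_add_succ _ (fin _ _ _), add_assoc]
  have e1 : ∀ i : ℕ, ((zchoose (a - 1 + (i + 1 : ℕ)) (i + 1) : ℤ) : ℂ) •
      A (a - 1 + (i + 1 : ℕ)) (b - (i + 1 : ℕ)) =
      ((zchoose (a + i) (i + 1) : ℤ) : ℂ) • A (a + i) (b - 1 - i) := by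
    intro i
    have h1 : a - 1 + ((i + 1 : ℕ) : ℤ) = a + i := by push_cast; ring
    have h2 : b - ((i + 1 : ℕ) : ℤ) = b - 1 - i := by push_cast; ring
    rw [h1, h2]
  have e2 : ∀ i : ℕ, ((zchoose (a + (i + 1 : ℕ)) (i + 1) : ℤ) : ℂ) •
      A (a + (i + 1 : ℕ) - 1) (b - (i + 1 : ℕ)) =
      ((zchoose (a + i) (i + 1) : ℤ) : ℂ) • A (a + i) (b - 1 - i) +
      ((zchoose (a + i) i : ℤ) : ℂ) • A (a + i) (b - 1 - i) := by
    intro i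
    rw [zchoose_succ, ← add_smul]
    have h1 : a + ((i + 1 : ℕ) : ℤ) - 1 = a + i := by push_cast; ring
    have h2 : b - ((i + 1 : ℕ) : ℤ) = b - 1 - i := by push_cast; ring
    rw [h1, h2]
    congr 1
    push_cast
    ring
  simp only [e1, e2]
  rw [finsum_add_distrib (fin _ _ _) (fin _ _ _)]
  simp [zchoose_zero_right]

theorem substAdd20_shiftFst (A : ℤ → ℤ → V) (N : ℤ)
    (hA : ∀ m n, m < N ∨ n < N → A m n = 0) :
    substAdd20 (shiftFst A) = (shiftFst + shiftSnd : Module.End ℂ (ℤ → ℤ → V)) (substAdd20 A) := by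
  have fin : ∀ (g : ℤ → ℂ) (b c : ℤ),
      (Function.support fun m : ℤ => g m • A m (b - m + c)).Finite := by
    intro g b c
    refine (Set.finite_Icc N (b + c - N)).subset fun i hi => ?_
    by_contra h
    refine hi ?_
    simp only [Set.mem_Icc] at h
    beta_reduce
    rw [hA _ _ (by omega), smul_zero]
  funext a b
  rw [shiftFst_add_shiftSnd_apply]
  simp only [substAdd20, shiftFst, LinearMap.coe_mk, AddHom.coe_mk]
  rcases lt_trichotomy a 0 with h | rfl | h
  · rw [if_neg (by omega), if_neg (by omega), if_neg (by omega), add_zero]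
  · simp only [zchoose_zero_right, le_refl, if_true, Int.toNat_zero]
    rw [if_neg (by omega), zero_add,
      ← finsum_comp_equiv (Equiv.addRight (1 : ℤ))]
    refine finsum_congr fun m => ?_
    simp only [Equiv.coe_addRight, add_sub_cancel_right]
    congr 2
    ring
  · obtain ⟨k, rfl⟩ : ∃ k : ℕ, a = k + 1 := ⟨(a - 1).toNat, by omega⟩
    rw [if_pos (by omega), if_pos (by omega), if_pos (by omega),
      ← finsum_comp_equiv (Equiv.addRight (1 : ℤ))]
    have h1 : ((k : ℤ) + 1).toNat = k + 1 := by omega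
    have h2 : ((k : ℤ) + 1 - 1).toNat = k := by omega
    simp only [h1, Equiv.coe_addRight, add_sub_cancel_right]
    rw [← finsum_add_distrib (fin _ _ _)]
    · refine finsum_congr fun m => ?_
      rw [zchoose_succ, add_sub_cancel_right]
      have h3 : b - (m + 1) + ((k : ℤ) + 1) = b - m + k := by ring
      have h4 : b - 1 - m + ((k : ℤ) + 1) = b - m + k := by ring
      rw [h3, h4, ← add_smul]
      push_cast
      rfl
    · exact fin _ _ _

theorem substAdd02_eq_substAdd20 (A : ℤ → ℤ → V) (hA : ∀ m n, m < 0 → A m n = 0) :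
    substAdd02 A = substAdd20 A := by
  funext a b
  simp only [substAdd02, substAdd20]
  split_ifs with ha
  · lift a to ℕ using ha
    have hr := finsum_mem_range (g := fun i : ℕ => (a : ℤ) + i)
      (f := fun m : ℤ => ((zchoose m (m - a).toNat : ℤ) : ℂ) • A m (b - m + a))
      (fun i j h => by simpa using h)
    refine Eq.trans (Eq.trans ?_ hr.symm) ?_
    rotate_left
    · classical
      refine finsum_congr fun m => ?_
      rw [finsum_eq_if]
      split_ifs with h
      · obtain ⟨i, rfl⟩ := h
        have h1 : ((a : ℤ) + i - a).toNat = i := by omega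
        rw [h1, Int.toNat_natCast]
        have h2 : zchoose ((a : ℤ) + i) i = zchoose ((a : ℤ) + i) a := by
          have := zchoose_natCast (a + i) i
          have h' := zchoose_natCast (a + i) a
          push_cast at this h'
          rw [this, h', Nat.choose_symm_add]
        rw [h2]
      · rcases lt_or_ge m 0 with hm | hm
        · rw [hA _ _ hm, smul_zero]
        · lift m to ℕ using hm
          have : m < a := by
            by_contra hlt
            exact h ⟨m - a, by beta_reduce; omega⟩
          rw [Int.toNat_natCast, zchoose_natCast, Nat.choose_eq_zero_of_lt this]
          simp
    · refine finsum_congr fun i => ?_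
      have h1 : ((a : ℤ) + i - a).toNat = i := by omega
      have h2 : b - ((a : ℤ) + i) + a = b - i := by ring
      rw [h1, h2]
  · refine finsum_eq_zero_of_forall_eq_zero fun i => ?_
    rcases lt_or_ge (a + i) 0 with hm | hm
    · rw [hA _ _ hm, smul_zero]
    · obtain ⟨c, hc⟩ := Int.eq_ofNat_of_zero_le hm
      rw [hc, zchoose_natCast, Nat.choose_eq_zero_of_lt (by omega)]
      simp

theorem eq_zero_of_shiftFst_add_shiftSnd_pow_eq_zero (k : ℕ) (D : ℤ → ℤ → V) (N : ℤ)
    (hD : ∀ m n, m < N → D m n = 0)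
    (h : ((shiftFst + shiftSnd : Module.End ℂ (ℤ → ℤ → V)) ^ k) D = 0) : D = 0 := by
  induction k generalizing D with
  | zero => simpa using h
  | succ k ih =>
    have h' : (shiftFst + shiftSnd : Module.End ℂ (ℤ → ℤ → V)) D = 0 := by
      refine ih _ (fun m n hm => ?_) (by rwa [pow_succ] at h)
      rw [shiftFst_add_shiftSnd_apply, hD _ _ (by omega), hD _ _ hm, add_zero]
    have key : ∀ (j : ℕ) (n : ℤ), D (N - 1 + j) n = 0 := by
      intro j
      induction j with
      | zero => intro n; exact hD _ _ (by simp)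
      | succ j ihj =>
        intro n
        have := congrFun (congrFun h' (N - 1 + (j + 1 : ℕ))) (n + 1)
        rw [shiftFst_add_shiftSnd_apply] at this
        have e : N - 1 + ((j + 1 : ℕ) : ℤ) - 1 = N - 1 + j := by push_cast; ring
        rwa [e, ihj, zero_add, add_sub_cancel_right] at this
    funext m n
    rcases lt_or_ge m N with hm | hm
    · exact hD _ _ hm
    · have := key (m - (N - 1)).toNat n
      rwa [Int.toNat_of_nonneg (by omega), add_sub_cancel] at this

/-- Weak associativity upgrades to strict associativity when the product of the two vertex
operators is a series truncated in both variables. -/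
theorem eq_substAdd20_of_mulAddPow_eq (A C : ℤ → ℤ → V) (k : ℕ) (hA : IsLaurent2 A)
    (N' : ℤ) (hC : ∀ a b, a < N' → C a b = 0)
    (h : ∀ a b, mulAddPow k (substAdd02 A) a b = mulAddPow k C a b) : C = substAdd20 A := by
  obtain ⟨N, hA⟩ := hA
  set T : Module.End ℂ (ℤ → ℤ → V) := shiftFst + shiftSnd with hT
  have h0 : (T ^ k) (substAdd02 A) = (T ^ k) C := by
    rw [hT, ← mulAddPow_eq_pow, ← mulAddPow_eq_pow]
    funext a b
    exact h a b
  have hbd : ∀ j : ℕ, ∀ m n, m < N + j ∨ n < N → (shiftFst ^ j) A m n = 0 := by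
    intro j m n hmn
    rw [shiftFst_pow_apply]
    exact hA _ _ (by omega)
  have h02 : ∀ j : ℕ, substAdd02 ((shiftFst ^ j) A) = (T ^ j) (substAdd02 A) := by
    intro j
    induction j with
    | zero => simp
    | succ j ih =>
      rw [pow_succ', pow_succ', Module.End.mul_apply, Module.End.mul_apply, ← ih]
      exact substAdd02_shiftFst _ N fun m n hn => hbd j m n (Or.inr hn)
  have h20 : ∀ j : ℕ, substAdd20 ((shiftFst ^ j) A) = (T ^ j) (substAdd20 A) := by
    intro j
    induction j with
    | zero => simp
    | succ j ih =>
      rw [pow_succ', pow_succ', Module.End.mul_apply, Module.End.mul_apply, ← ih]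
      exact substAdd20_shiftFst _ N fun m n hn => hbd j m n (by omega)
  set K := (-N).toNat with hK
  have hpos : substAdd02 ((shiftFst ^ (K + k)) A) = substAdd20 ((shiftFst ^ (K + k)) A) :=
    substAdd02_eq_substAdd20 _ fun m n hm => hbd _ m n (Or.inl (by push_cast; omega))
  have hz : (T ^ (K + k)) (C - substAdd20 A) = 0 := by
    rw [map_sub, ← h20, ← hpos, h02, pow_add, Module.End.mul_apply, Module.End.mul_apply, h0,
      sub_self]
  refine sub_eq_zero.mp (eq_zero_of_shiftFst_add_shiftSnd_pow_eq_zero (K + k) _ (min N' 0) ?_ hz)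
  intro m n hm
  simp only [Pi.sub_apply, substAdd20]
  rw [hC _ _ (by omega), if_neg (by omega), sub_zero]

end StrictAssociativity

section FamilySums

variable {ι A B C W : Type*} [AddCommGroup A] [Module ℂ A] [AddCommGroup B] [Module ℂ B]
  [AddCommGroup C] [Module ℂ C] [AddCommGroup W] [Module ℂ W]

/-- The sum of a family of linear maps that is pointwise finitely supported. -/
def finsumMap (F : ι → A →ₗ[ℂ] B) (hF : ∀ t, (Function.support fun i => F i t).Finite) :
    A →ₗ[ℂ] B where
  toFun t := ∑ᶠ i, F i t
  map_add' s t := by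
    simp only [map_add]
    exact finsum_add_distrib (hF s) (hF t)
  map_smul' c t := by
    simp only [map_smul, RingHom.id_apply]
    exact (smul_finsum' c (hF t)).symm

theorem finsumMap_apply (F : ι → A →ₗ[ℂ] B)
    (hF : ∀ t, (Function.support fun i => F i t).Finite) (t : A) :
    finsumMap F hF t = ∑ᶠ i, F i t := rfl

theorem finite_support_of_tmul (F : ι → A ⊗[ℂ] B →ₗ[ℂ] C)
    (hF : ∀ a b, (Function.support fun i => F i (a ⊗ₜ b)).Finite) (t : A ⊗[ℂ] B) :
    (Function.support fun i => F i t).Finite := by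
  induction t using TensorProduct.induction_on with
  | zero => simp
  | tmul a b => exact hF a b
  | add s t hs ht =>
    refine (hs.union ht).subset fun i hi => ?_
    by_contra h
    simp only [Set.mem_union, Function.mem_support, not_or, not_not] at h
    refine hi ?_
    simp only [map_add, h.1, h.2, add_zero]

theorem finite_support_rTensor (F : ι → A →ₗ[ℂ] B)
    (hF : ∀ t, (Function.support fun i => F i t).Finite) (t : A ⊗[ℂ] W) :
    (Function.support fun i => LinearMap.rTensor W (F i) t).Finite := by
  refine finite_support_of_tmul (fun i => LinearMap.rTensor W (F i)) (fun a w => ?_) t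
  refine (hF a).subset fun i hi h => hi ?_
  beta_reduce at h
  simp only [LinearMap.rTensor_tmul]
  rw [h, TensorProduct.zero_tmul]

theorem rTensor_finsumMap (F : ι → A →ₗ[ℂ] B)
    (hF : ∀ t, (Function.support fun i => F i t).Finite) :
    LinearMap.rTensor W (finsumMap F hF) =
      finsumMap (fun i => LinearMap.rTensor W (F i)) (finite_support_rTensor F hF) := by
  ext a w
  simp only [TensorProduct.AlgebraTensorModule.curry_apply, TensorProduct.curry_apply,
    LinearMap.coe_restrictScalars, LinearMap.rTensor_tmul, finsumMap_apply]
  exact ((TensorProduct.mk ℂ B W).flip w).toAddMonoidHom.map_finsum (hF a)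

end FamilySums

section Truncation

variable {A B C : Type*} [AddCommGroup A] [Module ℂ A] [AddCommGroup B] [Module ℂ B]
  [AddCommGroup C] [Module ℂ C]

theorem exists_bound_of_fg (L : A →ₗ[ℂ] (ℤ → C)) (hL : ∀ a, IsLaurent (L a))
    (F : Submodule ℂ A) (hF : F.FG) : ∃ M : ℤ, ∀ f ∈ F, ∀ n, n < M → L f n = 0 := by
  induction F, hF using Submodule.fg_induction with
  | singleton x =>
    obtain ⟨M, hM⟩ := hL x
    refine ⟨M, fun f hf n hn => ?_⟩
    obtain ⟨c, rfl⟩ := Submodule.mem_span_singleton.mp hf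
    rw [map_smul, Pi.smul_apply, hM n hn, smul_zero]
  | sup F₁ F₂ _ _ h₁ h₂ =>
    obtain ⟨M₁, h₁⟩ := h₁
    obtain ⟨M₂, h₂⟩ := h₂
    refine ⟨min M₁ M₂, fun f hf n hn => ?_⟩
    obtain ⟨f₁, hf₁, f₂, hf₂, rfl⟩ := Submodule.mem_sup.mp hf
    rw [map_add, Pi.add_apply, h₁ f₁ hf₁ n (by omega), h₂ f₂ hf₂ n (by omega), add_zero]

theorem exists_bound_of_fg₂ (L : A →ₗ[ℂ] B →ₗ[ℂ] (ℤ → C)) (hL : ∀ a b, IsLaurent (L a b))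
    (F : Submodule ℂ A) (hF : F.FG) (F' : Submodule ℂ B) (hF' : F'.FG) :
    ∃ M : ℤ, ∀ f ∈ F, ∀ f' ∈ F', ∀ n, n < M → L f f' n = 0 := by
  induction F, hF using Submodule.fg_induction with
  | singleton x =>
    obtain ⟨M, hM⟩ := exists_bound_of_fg (L x) (hL x) F' hF'
    refine ⟨M, fun f hf f' hf' n hn => ?_⟩
    obtain ⟨c, rfl⟩ := Submodule.mem_span_singleton.mp hf
    rw [map_smul, LinearMap.smul_apply, Pi.smul_apply, hM f' hf' n hn, smul_zero]
  | sup F₁ F₂ _ _ h₁ h₂ =>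
    obtain ⟨M₁, h₁⟩ := h₁
    obtain ⟨M₂, h₂⟩ := h₂
    refine ⟨min M₁ M₂, fun f hf f' hf' n hn => ?_⟩
    obtain ⟨f₁, hf₁, f₂, hf₂, rfl⟩ := Submodule.mem_sup.mp hf
    rw [map_add, LinearMap.add_apply, Pi.add_apply, h₁ f₁ hf₁ f' hf' n (by omega),
      h₂ f₂ hf₂ f' hf' n (by omega), add_zero]

theorem IsTensorLaurent.add {a b : ℤ → A} (ha : IsTensorLaurent a) (hb : IsTensorLaurent b) :
    IsTensorLaurent fun n => a n + b n := by
  obtain ⟨⟨N, hN⟩, F, hF, haF⟩ := ha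
  obtain ⟨⟨N', hN'⟩, F', hF', hbF⟩ := hb
  refine ⟨⟨min N N', fun n hn => ?_⟩, F ⊔ F', hF.sup hF', fun n => ?_⟩
  · beta_reduce
    rw [hN n (by omega), hN' n (by omega), add_zero]
  · exact Submodule.add_mem_sup (haF n) (hbF n)

theorem IsTensorLaurent.smul {a : ℤ → A} (ha : IsTensorLaurent a) (c : ℤ → ℂ) :
    IsTensorLaurent fun n => c n • a n := by
  obtain ⟨⟨N, hN⟩, F, hF, haF⟩ := ha
  refine ⟨⟨N, fun n hn => ?_⟩, F, hF, fun n => F.smul_mem _ (haF n)⟩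
  beta_reduce
  rw [hN n hn, smul_zero]

theorem IsTensorLaurent.map {a : ℤ → A} (ha : IsTensorLaurent a) (f : A →ₗ[ℂ] B) :
    IsTensorLaurent fun n => f (a n) := by
  obtain ⟨⟨N, hN⟩, F, hF, haF⟩ := ha
  refine ⟨⟨N, fun n hn => ?_⟩, F.map f, hF.map f, fun n => Submodule.mem_map_of_mem (haF n)⟩
  beta_reduce
  rw [hN n hn, map_zero]

theorem isTensorLaurent_of_tmul (F : ℤ → A ⊗[ℂ] B →ₗ[ℂ] C)
    (hF : ∀ a b, IsTensorLaurent fun n => F n (a ⊗ₜ b)) (t : A ⊗[ℂ] B) :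
    IsTensorLaurent fun n => F n t := by
  induction t using TensorProduct.induction_on with
  | zero => exact ⟨⟨0, fun n _ => map_zero _⟩, ⊥, Submodule.fg_bot, fun n => map_zero (F n)⟩
  | tmul a b => exact hF a b
  | add s t hs ht => simpa only [map_add] using hs.add ht

end Truncation

section Smash

variable {H U V : Type*} [AddCommGroup H] [Module ℂ H] [AddCommGroup U] [Module ℂ U]
  [AddCommGroup V] [Module ℂ V]

/-- Strict associativity for modules all of whose matrix series lie in `W ⊗ ℂ((x))`. -/
theorem NLVAModule.act_Y_eq_substAdd20 {𝒱 : NLVA V} (M : NLVAModule 𝒱 U)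
    (hM : ∀ v u, IsTensorLaurent fun n => M.Yw v u n) (h h' : V) (u : U) :
    (fun a b => M.Yw (𝒱.Y h h' a) u b) = substAdd20 fun m n => M.Yw h (M.Yw h' u n) m := by
  obtain ⟨k, hk⟩ := M.weak_assoc h h' u
  obtain ⟨N', hN'⟩ := 𝒱.trunc h h'
  refine eq_substAdd20_of_mulAddPow_eq _ _ k ?_ N' (fun a b ha => ?_) hk
  · obtain ⟨⟨N, hN⟩, F, hF, hmem⟩ := hM h' u
    obtain ⟨N₁, hN₁⟩ := exists_bound_of_fg (M.Yw h) (M.trunc h) F hF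
    refine ⟨min N N₁, fun m n hmn => ?_⟩
    rcases lt_or_ge n N with hn | hn
    · beta_reduce
      rw [show M.Yw h' u n = 0 from hN n hn, map_zero, Pi.zero_apply]
    · exact hN₁ _ (hmem n) _ (by omega)
  · rw [hN' a ha, map_zero, LinearMap.zero_apply, Pi.zero_apply]

variable (𝓗 : NLVBialg H) (MU : NLVModAlg 𝓗 U) (CV : NLVComodAlg 𝓗 V)

/-- The linear map `h ↦ h_{-n-1} u`, the coefficient of `x^n` in `Y(h,x)u`. -/
def NLVModAlg.actCoef {𝓗 : NLVBialg H} (MU : NLVModAlg 𝓗 U) (n : ℤ) (u : U) : H →ₗ[ℂ] U :=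
  (MU.act.Yw.compr₂ (LinearMap.proj n)).flip u

@[simp]
theorem NLVModAlg.actCoef_apply {𝓗 : NLVBialg H} (MU : NLVModAlg 𝓗 U) (n : ℤ) (u : U) (h : H) :
    MU.actCoef n u h = MU.act.Yw h u n := rfl

@[simp]
theorem NLVA.Yc_apply (𝒱 : NLVA V) (n : ℤ) (u v : V) : 𝒱.Yc n u v = 𝒱.Y u v n := rfl

theorem Rsmash_tmul (n : ℤ) (v : V) (u : U) :
    Rsmash 𝓗 MU CV n (v ⊗ₜ u) =
      ((-1 : ℂ) ^ n) • LinearMap.rTensor V (MU.actCoef n u) (CV.rho v) := by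
  simp only [Rsmash, LinearMap.smul_apply, LinearMap.comp_apply, LinearMap.rTensor_tmul]
  congr 1
  induction CV.rho v using TensorProduct.induction_on with
  | zero => simp
  | tmul h w => simp [smashSwap]
  | add s t hs ht => rw [TensorProduct.add_tmul, map_add, map_add, hs, ht, map_add]

theorem Rsmash_isTensorLaurent (t : V ⊗[ℂ] U) :
    IsTensorLaurent fun n => Rsmash 𝓗 MU CV n t := by
  refine isTensorLaurent_of_tmul _ (fun v u => ?_) t
  simp only [Rsmash_tmul]
  refine IsTensorLaurent.smul ?_ _
  refine isTensorLaurent_of_tmul (fun n => LinearMap.rTensor V (MU.actCoef n u)) (fun h w => ?_) _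
  exact (MU.scalar h u).map ((TensorProduct.mk ℂ U V).flip w)

theorem Rsmash_one_right (v : V) (n : ℤ) :
    Rsmash 𝓗 MU CV n (v ⊗ₜ MU.alg.one) = if n = 0 then MU.alg.one ⊗ₜ v else 0 := by
  rw [Rsmash_tmul]
  split_ifs with hn
  · subst hn
    have key : ∀ t : H ⊗[ℂ] V, LinearMap.rTensor V (MU.actCoef 0 MU.alg.one) t =
        MU.alg.one ⊗ₜ TensorProduct.lid ℂ V (LinearMap.rTensor V 𝓗.counit t) := by
      intro t
      induction t using TensorProduct.induction_on with
      | zero => simp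
      | tmul h w => simp [MU.vac, TensorProduct.smul_tmul]
      | add s t hs ht => simp only [map_add, hs, ht, TensorProduct.tmul_add]
    rw [key, CV.counit_rho, zpow_zero, one_smul]
  · have : MU.actCoef n MU.alg.one = 0 := by
      ext h
      simp [MU.vac, hn]
    rw [this, LinearMap.rTensor_zero, LinearMap.zero_apply, smul_zero]

theorem Rsmash_one_left (u : U) (n : ℤ) :
    Rsmash 𝓗 MU CV n (CV.alg.one ⊗ₜ u) = if n = 0 then u ⊗ₜ CV.alg.one else 0 := by
  rw [Rsmash_tmul, CV.rho_one, LinearMap.rTensor_tmul, MU.actCoef_apply, MU.act.vacuum]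
  split_ifs with hn
  · subst hn
    simp
  · simp

/-- The `(i,p)`-th term of the compatibility of the action with the vertex operators, as a
linear map in `Δ(h)`. -/
def NLVModAlg.compatTerm_s18 {𝓗 : NLVBialg H} (MU : NLVModAlg 𝓗 U) (u u' : U) (m n : ℤ)
    (ip : ℕ × ℤ) : H ⊗[ℂ] H →ₗ[ℂ] U :=
  ((-1 : ℂ) ^ ip.1 * ((zchoose ip.2 ip.1 : ℤ) : ℂ)) •
    TensorProduct.lift (((MU.alg.Yc (n - ip.1)).comp (MU.actCoef ip.2 u)).compl₂
      (MU.actCoef (m - ip.2 + ip.1) u'))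

theorem NLVModAlg.compatTerm_tmul {𝓗 : NLVBialg H} (MU : NLVModAlg 𝓗 U) (u u' : U) (m n : ℤ)
    (ip : ℕ × ℤ) (h h' : H) :
    MU.compatTerm_s18 u u' m n ip (h ⊗ₜ h') = ((-1 : ℂ) ^ ip.1 * ((zchoose ip.2 ip.1 : ℤ) : ℂ)) •
      MU.alg.Y (MU.act.Yw h u ip.2) (MU.act.Yw h' u' (m - ip.2 + ip.1)) (n - ip.1) := rfl

theorem NLVModAlg.finite_support_compatTerm {𝓗 : NLVBialg H} (MU : NLVModAlg 𝓗 U)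
    (u u' : U) (m n : ℤ) (t : H ⊗[ℂ] H) :
    (Function.support fun ip => MU.compatTerm_s18 u u' m n ip t).Finite := by
  refine finite_support_of_tmul _ (fun h h' => ?_) t
  obtain ⟨⟨N, hN⟩, F, hF, hmem⟩ := MU.scalar h u
  obtain ⟨⟨N', hN'⟩, F', hF', hmem'⟩ := MU.scalar h' u'
  obtain ⟨M, hM⟩ := exists_bound_of_fg₂ MU.alg.Y MU.alg.trunc F hF F' hF'
  refine ((Set.finite_Iic (n - M).toNat).prod
    (Set.finite_Icc N (m + (n - M).toNat - N'))).subset fun ip hip => ?_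
  have h1 : N ≤ ip.2 := by
    by_contra hlt
    refine hip ?_
    beta_reduce
    rw [compatTerm_tmul, show MU.act.Yw h u ip.2 = 0 from hN _ (by omega)]
    simp
  have h2 : N' ≤ m - ip.2 + ip.1 := by
    by_contra hlt
    refine hip ?_
    beta_reduce
    rw [compatTerm_tmul, show MU.act.Yw h' u' (m - ip.2 + ip.1) = 0 from hN' _ (by omega)]
    simp
  have h3 : M ≤ n - ip.1 := by
    by_contra hlt
    refine hip ?_
    beta_reduce
    rw [compatTerm_tmul, hM _ (hmem _) _ (hmem' _) _ (by omega), smul_zero]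
  simp only [Set.mem_prod, Set.mem_Iic, Set.mem_Icc]
  omega

theorem NLVModAlg.actCoef_Y {𝓗 : NLVBialg H} (MU : NLVModAlg 𝓗 U) (u u' : U) (m n : ℤ) :
    MU.actCoef m (MU.alg.Y u u' n) =
      (finsumMap (MU.compatTerm_s18 u u' m n) (MU.finite_support_compatTerm u u' m n)).comp
        𝓗.comul := by
  ext h
  rw [MU.actCoef_apply, MU.compat, LinearMap.comp_apply, finsumMap_apply,
    finsum_curry _ (MU.finite_support_compatTerm u u' m n _)]
  rfl

theorem neg_one_zpow_mul_zpow (m c : ℤ) (i : ℕ) :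
    ((-1 : ℂ) ^ (m - c + i)) * (-1) ^ c = (-1) ^ m * (-1) ^ i := by
  have h : (-1 : ℂ) ≠ 0 := by norm_num
  rw [← zpow_add₀ h, ← zpow_natCast, ← zpow_add₀ h]
  congr 1
  ring

theorem Rsmash_hex1 (v : V) (u u' : U) (m n : ℤ) :
    Rsmash 𝓗 MU CV m (v ⊗ₜ (MU.alg.Y u u' n)) =
      hex1RHS MU.alg (Rsmash 𝓗 MU CV) v u u' m n := by
  have hfin := finite_support_rTensor (W := V) _ (MU.finite_support_compatTerm u u' m n)
  set F := fun ip => LinearMap.rTensor V (MU.compatTerm_s18 u u' m n ip) with hFdef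
  have hterm : ∀ (i : ℕ) (c : ℤ), ((zchoose (m - c + i) i : ℤ) : ℂ) •
      (TensorProduct.map (TensorProduct.lift (MU.alg.Yc (n - i))) LinearMap.id)
        ((TensorProduct.assoc ℂ U U V).symm
          ((LinearMap.lTensor U (Rsmash 𝓗 MU CV c))
            ((TensorProduct.assoc ℂ U V U)
              ((Rsmash 𝓗 MU CV (m - c + i) (v ⊗ₜ u)) ⊗ₜ u')))) =
      ((-1 : ℂ) ^ m) • F (i, m - c + i)
        (LinearMap.rTensor V 𝓗.comul (CV.rho v)) := by
    intro i c
    have hco : LinearMap.rTensor V 𝓗.comul (CV.rho v) = (TensorProduct.assoc ℂ H H V).symm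
        ((LinearMap.lTensor H CV.rho) (CV.rho v)) := by
      rw [CV.coassoc, LinearEquiv.symm_apply_apply]
    rw [hco, Rsmash_tmul]
    induction CV.rho v using TensorProduct.induction_on with
    | zero => simp
    | add s t hs ht =>
      simp only [map_add, smul_add, TensorProduct.add_tmul] at hs ht ⊢
      rw [hs, ht]
    | tmul h w =>
      rw [LinearMap.rTensor_tmul, ← TensorProduct.smul_tmul', map_smul, TensorProduct.assoc_tmul,
        map_smul, LinearMap.lTensor_tmul, Rsmash_tmul, LinearMap.lTensor_tmul]
      induction CV.rho w using TensorProduct.induction_on with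
      | zero => simp
      | add s t hs ht =>
        simp only [map_add, smul_add, TensorProduct.tmul_add] at hs ht ⊢
        rw [hs, ht]
      | tmul h' w' =>
        simp only [hFdef, LinearMap.rTensor_tmul, TensorProduct.tmul_smul, map_smul,
          TensorProduct.assoc_symm_tmul, TensorProduct.map_tmul, TensorProduct.lift.tmul,
          NLVModAlg.compatTerm_tmul, LinearMap.id_apply, MU.actCoef_apply, NLVA.Yc_apply,
          ← TensorProduct.smul_tmul', smul_smul]
        have h1 : m - (m - c + i) + i = c := by ring
        rw [h1]
        congr 1
        linear_combination ((zchoose (m - c + i) i : ℤ) : ℂ) * neg_one_zpow_mul_zpow m c i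
  unfold hex1RHS
  rw [Rsmash_tmul, MU.actCoef_Y, LinearMap.rTensor_comp_apply, rTensor_finsumMap,
    finsumMap_apply, smul_finsum' _ (hfin _), finsum_curry]
  · refine finsum_congr fun i => ?_
    rw [← finsum_comp_equiv (Equiv.subLeft (m + i))]
    refine finsum_congr fun c => ?_
    rw [hterm, Equiv.subLeft_apply, show m + (i : ℤ) - c = m - c + i by ring]
  · exact (hfin (LinearMap.rTensor V 𝓗.comul (CV.rho v))).subset
      fun ip hip h => hip (by beta_reduce at h ⊢; rw [h, smul_zero])

/-- The coefficient of `x^p` in `Y(Y(b¹(v),x)b¹(v'),z)u ⊗ Y(v²,x)v'²`, taken at `x^n z^m`,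
as a linear map in `ρ(v) ⊗ ρ(v')`. -/
def leftTerm (u : U) (m n p : ℤ) : (H ⊗[ℂ] V) ⊗[ℂ] (H ⊗[ℂ] V) →ₗ[ℂ] U ⊗[ℂ] V :=
  (LinearMap.rTensor V (MU.actCoef m u)).comp
    (TensorProduct.lift (TensorProduct.map₂ (𝓗.alg.Yc p) (CV.alg.Yc (n - p))))

theorem leftTerm_tmul (u : U) (m n p : ℤ) (h h' : H) (w w' : V) :
    leftTerm 𝓗 MU CV u m n p ((h ⊗ₜ w) ⊗ₜ (h' ⊗ₜ w')) =
      MU.act.Yw (𝓗.alg.Y h h' p) u m ⊗ₜ CV.alg.Y w w' (n - p) := by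
  simp [leftTerm]

/-- The `(i,c)`-th term of `Y(b¹(v),z+x)Y(b¹(v'),z)u ⊗ Y(v²,x)v'²`, taken at `x^n z^m`,
as a linear map in `ρ(v) ⊗ ρ(v')`. -/
def rightTerm (u : U) (m n : ℤ) (ic : ℕ × ℤ) :
    (H ⊗[ℂ] V) ⊗[ℂ] (H ⊗[ℂ] V) →ₗ[ℂ] U ⊗[ℂ] V :=
  ((zchoose (m - ic.2 + ic.1) ic.1 : ℤ) : ℂ) •
    TensorProduct.lift (TensorProduct.map₂
      (((MU.act.Yw.compr₂ (LinearMap.proj (m - ic.2 + ic.1))).compl₂ (MU.actCoef ic.2 u)))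
      (CV.alg.Yc (n - ic.1)))

theorem rightTerm_tmul (u : U) (m n : ℤ) (ic : ℕ × ℤ) (h h' : H) (w w' : V) :
    rightTerm 𝓗 MU CV u m n ic ((h ⊗ₜ w) ⊗ₜ (h' ⊗ₜ w')) =
      ((zchoose (m - ic.2 + ic.1) ic.1 : ℤ) : ℂ) •
        (MU.act.Yw h (MU.act.Yw h' u ic.2) (m - ic.2 + ic.1) ⊗ₜ CV.alg.Y w w' (n - ic.1)) := by
  simp [rightTerm]

theorem finite_support_of_tmul_tmul {ι A B C D E : Type*} [AddCommGroup A] [Module ℂ A]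
    [AddCommGroup B] [Module ℂ B] [AddCommGroup C] [Module ℂ C] [AddCommGroup D] [Module ℂ D]
    [AddCommGroup E] [Module ℂ E] (F : ι → (A ⊗[ℂ] B) ⊗[ℂ] (C ⊗[ℂ] D) →ₗ[ℂ] E)
    (hF : ∀ a b c d, (Function.support fun i => F i ((a ⊗ₜ b) ⊗ₜ (c ⊗ₜ d))).Finite)
    (t : (A ⊗[ℂ] B) ⊗[ℂ] (C ⊗[ℂ] D)) : (Function.support fun i => F i t).Finite := by
  refine finite_support_of_tmul _ (fun s s' => ?_) t
  refine finite_support_of_tmul (fun i => (F i).comp ((TensorProduct.mk ℂ _ _).flip s'))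
    (fun a b => ?_) s
  exact finite_support_of_tmul (fun i => (F i).comp (TensorProduct.mk ℂ _ _ (a ⊗ₜ b)))
    (hF a b) s'

theorem finite_support_leftTerm (u : U) (m n : ℤ) (t : (H ⊗[ℂ] V) ⊗[ℂ] (H ⊗[ℂ] V)) :
    (Function.support fun p => leftTerm 𝓗 MU CV u m n p t).Finite := by
  refine finite_support_of_tmul_tmul _ (fun h w h' w' => ?_) t
  obtain ⟨N, hN⟩ := 𝓗.alg.trunc h h'
  obtain ⟨M, hM⟩ := CV.alg.trunc w w'
  refine (Set.finite_Icc N (n - M)).subset fun p hp => ?_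
  by_contra hcon
  rw [Set.mem_Icc, not_and_or] at hcon
  refine hp ?_
  beta_reduce
  rw [leftTerm_tmul]
  rcases hcon with hcon | hcon
  · simp [hN p (by omega)]
  · simp [hM (n - p) (by omega)]

theorem finite_support_rightTerm (u : U) (m n : ℤ) (t : (H ⊗[ℂ] V) ⊗[ℂ] (H ⊗[ℂ] V)) :
    (Function.support fun ic => rightTerm 𝓗 MU CV u m n ic t).Finite := by
  refine finite_support_of_tmul_tmul _ (fun h w h' w' => ?_) t
  obtain ⟨⟨N, hN⟩, F, hF, hmem⟩ := MU.scalar h' u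
  obtain ⟨N', hN'⟩ := exists_bound_of_fg (MU.act.Yw h) (MU.act.trunc h) F hF
  obtain ⟨M, hM⟩ := CV.alg.trunc w w'
  refine ((Set.finite_Iic (n - M).toNat).prod
    (Set.finite_Icc N (m + (n - M).toNat - N'))).subset fun ic hic => ?_
  have h1 : N ≤ ic.2 := by
    by_contra hlt
    refine hic ?_
    beta_reduce
    rw [rightTerm_tmul, show MU.act.Yw h' u ic.2 = 0 from hN _ (by omega)]
    simp
  have h2 : N' ≤ m - ic.2 + ic.1 := by
    by_contra hlt
    refine hic ?_
    beta_reduce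
    rw [rightTerm_tmul, hN' _ (hmem _) _ (by omega)]
    simp
  have h3 : M ≤ n - ic.1 := by
    by_contra hlt
    refine hic ?_
    beta_reduce
    rw [rightTerm_tmul, hM _ (by omega)]
    simp
  simp only [Set.mem_prod, Set.mem_Iic, Set.mem_Icc]
  omega

theorem NLVModAlg.act_Y {𝓗 : NLVBialg H} (MU : NLVModAlg 𝓗 U) (h h' : H) (u : U) (p m : ℤ) :
    MU.act.Yw (𝓗.alg.Y h h' p) u m = if 0 ≤ p then
      ∑ᶠ c : ℤ, ((zchoose (m - c + p.toNat) p.toNat : ℤ) : ℂ) •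
        MU.act.Yw h (MU.act.Yw h' u c) (m - c + p.toNat) else 0 := by
  have := congrFun (congrFun (MU.act.act_Y_eq_substAdd20 MU.scalar h h' u) p) m
  beta_reduce at this
  rw [this, substAdd20]
  split_ifs with hp
  · rw [← finsum_comp_equiv (Equiv.subLeft (m + p))]
    refine finsum_congr fun c => ?_
    rw [Equiv.subLeft_apply, Int.toNat_of_nonneg hp, show m - (m + p - c) + p = c by ring,
      show m + p - c = m - c + p by ring]
  · rfl

theorem finsumMap_leftTerm_eq (u : U) (m n : ℤ) :
    finsumMap (leftTerm 𝓗 MU CV u m n) (finite_support_leftTerm 𝓗 MU CV u m n) =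
      finsumMap (rightTerm 𝓗 MU CV u m n) (finite_support_rightTerm 𝓗 MU CV u m n) := by
  ext h w h' w'
  change finsumMap (leftTerm 𝓗 MU CV u m n) (finite_support_leftTerm 𝓗 MU CV u m n)
      ((h ⊗ₜ w) ⊗ₜ (h' ⊗ₜ w')) =
    finsumMap (rightTerm 𝓗 MU CV u m n) (finite_support_rightTerm 𝓗 MU CV u m n)
      ((h ⊗ₜ w) ⊗ₜ (h' ⊗ₜ w'))
  rw [finsumMap_apply, finsumMap_apply, finsum_curry _ (finite_support_rightTerm 𝓗 MU CV u m n _)]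
  have hr := finsum_mem_range (g := fun i : ℕ => (i : ℤ))
    (f := fun p => leftTerm 𝓗 MU CV u m n p ((h ⊗ₜ w) ⊗ₜ (h' ⊗ₜ w'))) Nat.cast_injective
  refine Eq.trans (Eq.trans ?_ hr) ?_
  · classical
    refine finsum_congr fun p => ?_
    rw [finsum_eq_if]
    split_ifs with hp
    · rfl
    · rw [leftTerm_tmul, MU.act_Y, if_neg, TensorProduct.zero_tmul]
      exact fun h0 => hp ⟨p.toNat, Int.toNat_of_nonneg h0⟩
  · refine finsum_congr fun i => ?_
    simp only [leftTerm_tmul, rightTerm_tmul]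
    rw [MU.act_Y, if_pos (Int.natCast_nonneg i), Int.toNat_natCast]
    obtain ⟨⟨N, hN⟩, F, hF, hmem⟩ := MU.scalar h' u
    obtain ⟨N', hN'⟩ := exists_bound_of_fg (MU.act.Yw h) (MU.act.trunc h) F hF
    refine (((TensorProduct.mk ℂ U V).flip (CV.alg.Y w w' (n - i))).toAddMonoidHom.map_finsum
      ?_).trans (finsum_congr fun c => TensorProduct.smul_tmul' _ _ _)
    refine (Set.finite_Icc N (m + i - N')).subset fun c hc => ?_
    by_contra hcon
    rw [Set.mem_Icc, not_and_or] at hcon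
    refine hc ?_
    beta_reduce
    rcases hcon with hcon | hcon
    · rw [show MU.act.Yw h' u c = 0 from hN _ (by omega)]
      simp
    · rw [hN' _ (hmem _) _ (by omega), smul_zero]

theorem Rsmash_hex2 (v v' : V) (u : U) (m n : ℤ) :
    Rsmash 𝓗 MU CV m ((CV.alg.Y v v' n) ⊗ₜ u) =
      hex2RHS CV.alg (Rsmash 𝓗 MU CV) v v' u m n := by
  have hterm : ∀ (i : ℕ) (c : ℤ), ((-1 : ℂ) ^ i * ((zchoose (m - c + i) i : ℤ) : ℂ)) •
      (LinearMap.lTensor U (TensorProduct.lift (CV.alg.Yc (n - i))))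
        ((TensorProduct.assoc ℂ U V V)
          ((TensorProduct.map (Rsmash 𝓗 MU CV (m - c + i)) LinearMap.id)
            ((TensorProduct.assoc ℂ V U V).symm
              (v ⊗ₜ (Rsmash 𝓗 MU CV c (v' ⊗ₜ u)))))) =
      ((-1 : ℂ) ^ m) • rightTerm 𝓗 MU CV u m n (i, c) (CV.rho v ⊗ₜ CV.rho v') := by
    intro i c
    rw [Rsmash_tmul]
    induction CV.rho v' using TensorProduct.induction_on with
    | zero => simp
    | add s t hs ht =>
      simp only [map_add, smul_add, TensorProduct.tmul_add] at hs ht ⊢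
      rw [hs, ht]
    | tmul h' w' =>
      rw [LinearMap.rTensor_tmul, TensorProduct.tmul_smul, map_smul,
        TensorProduct.assoc_symm_tmul, map_smul, TensorProduct.map_tmul, Rsmash_tmul]
      induction CV.rho v using TensorProduct.induction_on with
      | zero => simp
      | add s t hs ht =>
        simp only [map_add, smul_add, TensorProduct.add_tmul] at hs ht ⊢
        rw [hs, ht]
      | tmul h w =>
        simp only [LinearMap.rTensor_tmul, map_smul, LinearMap.lTensor_tmul,
          TensorProduct.assoc_tmul, TensorProduct.lift.tmul, rightTerm_tmul, LinearMap.id_apply,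
          MU.actCoef_apply, NLVA.Yc_apply, ← TensorProduct.smul_tmul', smul_smul]
        congr 1
        have h1 : ((-1 : ℂ) ^ i) * (-1) ^ i = 1 := by
          rw [← mul_pow]
          simp
        linear_combination (-1 : ℂ) ^ i * ((zchoose (m - c + i) i : ℤ) : ℂ) *
          neg_one_zpow_mul_zpow m c i + (-1 : ℂ) ^ m * ((zchoose (m - c + i) i : ℤ) : ℂ) * h1
  have hleft : LinearMap.rTensor V (MU.actCoef m u) (CV.rho (CV.alg.Y v v' n)) =
      finsumMap (leftTerm 𝓗 MU CV u m n) (finite_support_leftTerm 𝓗 MU CV u m n)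
        (CV.rho v ⊗ₜ CV.rho v') := by
    have hfin : ∀ t : (H ⊗[ℂ] V) ⊗[ℂ] (H ⊗[ℂ] V), (Function.support fun p =>
        TensorProduct.lift (TensorProduct.map₂ (𝓗.alg.Yc p) (CV.alg.Yc (n - p))) t).Finite := by
      refine finite_support_of_tmul_tmul _ fun h w h' w' => ?_
      obtain ⟨N, hN⟩ := 𝓗.alg.trunc h h'
      obtain ⟨M, hM⟩ := CV.alg.trunc w w'
      refine (Set.finite_Icc N (n - M)).subset fun p hp => ?_
      by_contra hcon
      rw [Set.mem_Icc, not_and_or] at hcon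
      refine hp ?_
      rcases hcon with hcon | hcon
      · simp [hN p (by omega)]
      · simp [hM (n - p) (by omega)]
    rw [CV.rho_mul]
    exact (LinearMap.rTensor V (MU.actCoef m u)).toAddMonoidHom.map_finsum
      (hfin (CV.rho v ⊗ₜ CV.rho v'))
  have hfin := finite_support_rightTerm 𝓗 MU CV u m n (CV.rho v ⊗ₜ CV.rho v')
  unfold hex2RHS
  simp only [hterm]
  rw [Rsmash_tmul, hleft, finsumMap_leftTerm_eq, finsumMap_apply, smul_finsum' _ hfin,
    finsum_curry]
  exact hfin.subset fun ic hic h => hic (by beta_reduce at h ⊢; rw [h, smul_zero])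

/-- The twisting operator `R(x)(v⊗u) = Y(b¹(v),-x)u ⊗ v²` attached to a module-algebra and a
comodule-algebra. -/
def smashTwistingOp : TwistingOp MU.alg CV.alg where
  Rc := Rsmash 𝓗 MU CV
  laurent := Rsmash_isTensorLaurent 𝓗 MU CV
  vac_right := Rsmash_one_right 𝓗 MU CV
  vac_left := Rsmash_one_left 𝓗 MU CV
  hex1 := Rsmash_hex1 𝓗 MU CV
  hex2 := Rsmash_hex2 𝓗 MU CV

theorem Ysharp_eq_YRcoef (u u' : U) (v v' : V) (n : ℤ) :
    Ysharp 𝓗 MU CV u v u' v' n =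
      YRcoef MU.alg CV.alg (smashTwistingOp 𝓗 MU CV) u v u' v' n := by
  set G : ℤ × ℤ → H ⊗[ℂ] V →ₗ[ℂ] U ⊗[ℂ] V := fun ap => TensorProduct.map
    ((MU.alg.Yc ap.1 u).comp (MU.actCoef ap.2 u')) ((CV.alg.Yc (n - ap.1 - ap.2)).flip v')
    with hG
  have hfin : ∀ t, (Function.support fun ap => G ap t).Finite := by
    refine finite_support_of_tmul G fun h w => ?_
    obtain ⟨⟨N, hN⟩, F, hF, hmem⟩ := MU.scalar h u'
    obtain ⟨M, hM⟩ := exists_bound_of_fg (MU.alg.Y u) (MU.alg.trunc u) F hF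
    obtain ⟨K, hK⟩ := CV.alg.trunc w v'
    have hGt : ∀ ap, G ap (h ⊗ₜ w) = MU.alg.Y u (MU.act.Yw h u' ap.2) ap.1 ⊗ₜ
      CV.alg.Y w v' (n - ap.1 - ap.2) := fun _ => rfl
    refine ((Set.finite_Icc M (n - K - N)).prod (Set.finite_Icc N (n - K - M))).subset
      fun ap hap => ?_
    rw [Function.mem_support, hGt] at hap
    have h1 : N ≤ ap.2 := by
      by_contra hlt
      refine hap ?_
      rw [show MU.act.Yw h u' ap.2 = 0 from hN _ (by omega)]
      simp
    have h2 : M ≤ ap.1 := by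
      by_contra hlt
      refine hap ?_
      rw [hM _ (hmem _) _ (by omega), TensorProduct.zero_tmul]
    have h3 : K ≤ n - ap.1 - ap.2 := by
      by_contra hlt
      refine hap ?_
      rw [hK _ (by omega), TensorProduct.tmul_zero]
    simp only [Set.mem_prod, Set.mem_Icc]
    omega
  have hR : ∀ c a : ℤ, ((-1 : ℂ) ^ c) •
      (TensorProduct.map (MU.alg.Yc a u) ((CV.alg.Yc (n - c - a)).flip v'))
        ((smashTwistingOp 𝓗 MU CV).Rc c (v ⊗ₜ u')) = G (a, c) (CV.rho v) := by
    intro c a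
    have h1 : ((-1 : ℂ) ^ c) * (-1) ^ c = 1 := by
      rw [← mul_zpow]
      simp
    change _ • TensorProduct.map _ _ (Rsmash 𝓗 MU CV c (v ⊗ₜ u')) = _
    rw [Rsmash_tmul, map_smul, smul_smul, h1, one_smul, sub_right_comm, hG,
      LinearMap.map_rTensor]
  unfold Ysharp YRcoef
  simp only [hR]
  refine (finsum_curry _ (hfin (CV.rho v))).symm.trans ?_
  rw [← finsum_comp_equiv (Equiv.prodComm ℤ ℤ), finsum_curry]
  · rfl
  · exact (hfin (CV.rho v)).preimage (Equiv.prodComm ℤ ℤ).injective.injOn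

end Smash

/-- The map `R(x)(v⊗u) = Y(b¹(v),-x)u ⊗ v²` is a twisting operator
for `(U,V)`, and the smash product `U ♯ V` coincides with the twisted tensor
product `U ⊗_R V` (Proposition 4.5). -/
theorem statement_18 {H U V : Type*} [AddCommGroup H] [Module ℂ H]
    [AddCommGroup U] [Module ℂ U] [AddCommGroup V] [Module ℂ V]
    (𝓗 : NLVBialg H) (MU : NLVModAlg 𝓗 U) (CV : NLVComodAlg 𝓗 V) :
    ∃ Rop : TwistingOp MU.alg CV.alg,
      (∀ n : ℤ, Rop.Rc n = Rsmash 𝓗 MU CV n) ∧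
      ∀ (u u' : U) (v v' : V) (n : ℤ),
        Ysharp 𝓗 MU CV u v u' v' n = YRcoef MU.alg CV.alg Rop u v u' v' n := by
  exact ⟨smashTwistingOp 𝓗 MU CV, fun _ => rfl, Ysharp_eq_YRcoef 𝓗 MU CV⟩
end
end
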